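/- arXiv:2408.03153 — 2 statements merged into one kernel-verified Lean document; each statement's English description precedes it below -/
import Mathlib

section
/- Let (α, β, γ) ∈ ℝ³ with α being κ-Diophantine for some κ ≥ 1, and define φ: ℕ → 𝕋² = ℝ²/ℤ² by φ(m) = (2αm + β, αm² + βm + γ) mod 1. Fix 0 < ν < 1/(4κ). Then there exist constants 0 < c₁ ≤ c₂ and T₀ ≥ 1 (depending on α, β, γ, κ, ν) such that for all T ≥ T₀, all δ with T^{−ν} ≤ δ < 1, and every v₀ ∈ 𝕋²: c₁ T δ² ≤ #{1 ≤ m ≤ T : ‖φ(m) − v₀‖_{𝕋²} ≤ δ} ≤ c₂ T δ². -/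
open Finset

/-- quotient distance on the torus ℝ²/ℤ² (Euclidean norm) -/
noncomputable def torusDist (x y : ℝ × ℝ) : ℝ :=
  ⨅ v : ℤ × ℤ, Real.sqrt ((x.1 - y.1 + (v.1 : ℝ)) ^ 2 + (x.2 - y.2 + (v.2 : ℝ)) ^ 2)

/-- The additive character `x ↦ exp (2πix)` of `ℝ`. -/
noncomputable def fourierExp (x : ℝ) : ℂ := Complex.exp (((2 * Real.pi * x : ℝ) : ℂ) * Complex.I)

lemma norm_fourierExp (x : ℝ) : ‖fourierExp x‖ = 1 := Complex.norm_exp_ofReal_mul_I _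

lemma fourierExp_add (x y : ℝ) : fourierExp (x + y) = fourierExp x * fourierExp y := by
  simp only [fourierExp]
  rw [← Complex.exp_add]
  congr 1
  push_cast
  ring

@[simp] lemma fourierExp_zero : fourierExp 0 = 1 := by simp [fourierExp]

lemma fourierExp_neg (x : ℝ) : fourierExp (-x) = (starRingEnd ℂ) (fourierExp x) := by
  simp only [fourierExp]
  rw [← Complex.exp_conj, map_mul, Complex.conj_I, Complex.conj_ofReal]
  congr 1
  push_cast
  ring

lemma fourierExp_intCast (k : ℤ) : fourierExp k = 1 := by
  rw [fourierExp, Complex.exp_eq_one_iff]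
  exact ⟨k, by push_cast; ring⟩

lemma fourierExp_eq (x : ℝ) : fourierExp x =
    (Real.cos (2 * Real.pi * x) : ℂ) + (Real.sin (2 * Real.pi * x) : ℂ) * Complex.I := by
  rw [fourierExp, Complex.exp_mul_I, Complex.ofReal_cos, Complex.ofReal_sin]

lemma fourierExp_natCast_mul (n : ℕ) (x : ℝ) : fourierExp (n * x) = fourierExp x ^ n := by
  rw [fourierExp, fourierExp, ← Complex.exp_nat_mul]
  congr 1
  push_cast
  ring

lemma norm_fourierExp_sub_one (x : ℝ) :
    ‖fourierExp x - 1‖ = 2 * |Real.sin (Real.pi * x)| := by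
  rw [fourierExp, mul_comm, Complex.norm_exp_I_mul_ofReal_sub_one, Real.norm_eq_abs, abs_mul,
    abs_two]
  congr 3
  ring

lemma two_mul_min_fract_le_abs_sin (x : ℝ) :
    2 * min (Int.fract x) (1 - Int.fract x) ≤ |Real.sin (Real.pi * x)| := by
  have h0 := Int.fract_nonneg x
  have h1 := Int.fract_lt_one x
  have hpi := Real.pi_pos
  have hs : |Real.sin (Real.pi * x)| = |Real.sin (Real.pi * Int.fract x)| := by
    have : Real.pi * x = Real.pi * Int.fract x + ⌊x⌋ * Real.pi := by
      rw [← Int.self_sub_floor]; ring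
    rw [this, Real.sin_add_int_mul_pi, abs_mul, abs_zpow, abs_neg, abs_one, one_zpow, one_mul]
  rw [hs]
  refine le_trans ?_ (le_abs_self _)
  rcases le_total (Int.fract x) (1 / 2) with h | h
  · have := Real.mul_le_sin (x := Real.pi * Int.fract x) (by positivity) (by nlinarith)
    rw [min_eq_left (by linarith)]
    calc _ = 2 / Real.pi * (Real.pi * Int.fract x) := by field_simp
      _ ≤ _ := this
  · have := Real.mul_le_sin (x := Real.pi * (1 - Int.fract x))
      (mul_nonneg hpi.le (by linarith)) (by nlinarith)
    rw [min_eq_right (by linarith), ← Real.sin_pi_sub (Real.pi * Int.fract x)]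
    calc _ = 2 / Real.pi * (Real.pi * (1 - Int.fract x)) := by field_simp
      _ ≤ Real.sin (Real.pi * (1 - Int.fract x)) := this
      _ = _ := by ring_nf

lemma norm_sum_fourierExp_mul_min_fract_le (N : ℕ) (θ : ℝ) :
    ‖∑ m ∈ range N, fourierExp (m * θ)‖ * (2 * min (Int.fract θ) (1 - Int.fract θ)) ≤ 1 := by
  simp only [fourierExp_natCast_mul]
  have h := geom_sum_mul (fourierExp θ) N
  have h2 : ‖fourierExp θ ^ N - 1‖ ≤ 2 := by
    refine (norm_sub_le _ _).trans ?_
    rw [norm_pow, norm_fourierExp]; norm_num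
  rw [← h, norm_mul, norm_fourierExp_sub_one] at h2
  have := mul_le_mul_of_nonneg_left (two_mul_min_fract_le_abs_sin θ)
    (norm_nonneg (∑ i ∈ range N, fourierExp θ ^ i))
  linarith

lemma norm_sum_fourierExp_le_card (N : ℕ) (f : ℕ → ℝ) :
    ‖∑ m ∈ range N, fourierExp (f m)‖ ≤ N := by
  refine (norm_sum_le _ _).trans ?_
  simp [norm_fourierExp]

/-- The index of the interval `[b/n, (b+1)/n)` containing the fractional part of `θ`. -/
noncomputable def fractBin (n : ℕ) (θ : ℝ) : ℕ := ⌊n * Int.fract θ⌋₊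

/-- A majorant, constant on bins, of the geometric sums with ratio `fourierExp θ` and at most `n`
terms. -/
noncomputable def binBound (n : ℕ) (θ : ℝ) : ℝ :=
  n / ((fractBin n θ : ℝ) + 1) + n / ((n : ℝ) - fractBin n θ)

lemma fractBin_lt {n : ℕ} (hn : 0 < n) (θ : ℝ) : fractBin n θ < n := by
  have h1 := Int.fract_lt_one θ
  have hn' : (0 : ℝ) < n := by exact_mod_cast hn
  rw [fractBin, Nat.floor_lt (by have := Int.fract_nonneg θ; positivity)]
  nlinarith

lemma binBound_nonneg {n : ℕ} (hn : 0 < n) (θ : ℝ) : 0 ≤ binBound n θ := by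
  have : (fractBin n θ : ℝ) < n := by exact_mod_cast fractBin_lt hn θ
  have : (0 : ℝ) < n - fractBin n θ := by linarith
  unfold binBound
  positivity

lemma norm_sum_fourierExp_le_binBound {n N : ℕ} (hn : 0 < n) (hN : N ≤ n) (θ : ℝ) :
    ‖∑ m ∈ range N, fourierExp (m * θ)‖ ≤ binBound n θ := by
  have hn' : (0 : ℝ) < n := by exact_mod_cast hn
  have hN' : (N : ℝ) ≤ n := by exact_mod_cast hN
  have h0 := Int.fract_nonneg θ
  have h1 := Int.fract_lt_one θ
  have hb : fractBin n θ + 1 ≤ n := fractBin_lt hn θ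
  have hle : (fractBin n θ : ℝ) ≤ n * Int.fract θ := Nat.floor_le (by positivity)
  have hlt : n * Int.fract θ < fractBin n θ + 1 := Nat.lt_floor_add_one _
  have hA := norm_sum_fourierExp_mul_min_fract_le N θ
  have hC := (norm_sum_fourierExp_le_card N (fun m => m * θ)).trans hN'
  unfold binBound
  generalize hbb : fractBin n θ = b at *
  set S := ‖∑ m ∈ range N, fourierExp (m * θ)‖ with hS
  have hS0 : 0 ≤ S := norm_nonneg _
  have hb' : (b : ℝ) + 1 ≤ n := by exact_mod_cast hb
  have hp1 : (0 : ℝ) ≤ n / ((b : ℝ) + 1) := by positivity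
  have hp2 : (0 : ℝ) ≤ n / ((n : ℝ) - b) := div_nonneg hn'.le (by linarith)
  rcases le_total (Int.fract θ) (1 / 2) with h | h
  · rw [min_eq_left (by linarith)] at hA
    suffices S ≤ n / ((b : ℝ) + 1) by linarith
    rw [le_div_iff₀ (by positivity)]
    rcases Nat.eq_zero_or_pos b with rfl | hbp
    · simpa using hC
    · have hb1 : (1 : ℝ) ≤ b := by exact_mod_cast hbp
      have : S * (b + 1) ≤ S * (2 * (n * Int.fract θ)) :=
        mul_le_mul_of_nonneg_left (by linarith) hS0
      nlinarith
  · rw [min_eq_right (by linarith)] at hA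
    suffices S ≤ n / ((n : ℝ) - b) by linarith
    rw [le_div_iff₀ (by linarith)]
    rcases hb.eq_or_lt with hbe | hbp
    · have : (b : ℝ) + 1 = n := by exact_mod_cast hbe
      have : (n : ℝ) - b = 1 := by linarith
      rw [this]; linarith
    · have hb1 : (b : ℝ) + 1 + 1 ≤ n := by exact_mod_cast hbp
      have : S * (n - b) ≤ S * (2 * (n * (1 - Int.fract θ))) :=
        mul_le_mul_of_nonneg_left (by linarith) hS0
      nlinarith

lemma normSq_sum_range (z : ℕ → ℂ) (n : ℕ) :
    ‖∑ m ∈ range n, z m‖ ^ 2 ≤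
      2 * ∑ h ∈ range n, ‖∑ m ∈ range (n - h), z (m + h) * (starRingEnd ℂ) (z m)‖ := by
  have key : ‖∑ m ∈ range n, z m‖ ^ 2 ≤
      2 * (∑ m ∈ range n, ∑ h ∈ range (m + 1), z m * (starRingEnd ℂ) (z (m - h))).re := by
    induction n with
    | zero => simp
    | succ n ih =>
      rw [sum_range_succ, sum_range_succ (f := fun m => ∑ h ∈ range (m + 1), _)]
      have hr : ∑ h ∈ range (n + 1), z n * (starRingEnd ℂ) (z (n - h)) =
          z n * (starRingEnd ℂ) (∑ m ∈ range n, z m) + z n * (starRingEnd ℂ) (z n) := by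
        have := sum_range_reflect (fun j => z n * (starRingEnd ℂ) (z j)) (n + 1)
        simp only [Nat.add_sub_cancel] at this
        rw [this, sum_range_succ, map_sum, mul_sum]
      rw [hr]
      generalize ∑ m ∈ range n, z m = S at *
      rw [Complex.sq_norm, Complex.normSq_apply] at ih ⊢
      simp only [Complex.add_re, Complex.add_im, Complex.mul_re, Complex.conj_re,
        Complex.conj_im] at ih ⊢
      nlinarith [sq_nonneg (z n).re, sq_nonneg (z n).im]
  have flip := sum_range_diag_flip n (fun h m => z (m + h) * (starRingEnd ℂ) (z m))
  have heq : ∑ m ∈ range n, ∑ h ∈ range (m + 1), z m * (starRingEnd ℂ) (z (m - h)) =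
      ∑ h ∈ range n, ∑ m ∈ range (n - h), z (m + h) * (starRingEnd ℂ) (z m) := by
    rw [← flip]
    refine sum_congr rfl fun m _ => sum_congr rfl fun h hh => ?_
    rw [Nat.sub_add_cancel (by have := mem_range.1 hh; omega)]
  rw [heq] at key
  refine key.trans ?_
  gcongr
  exact (Complex.re_le_norm _).trans (norm_sum_le _ _)

lemma norm_sum_fourierExp_sub_const (n : ℕ) (f : ℕ → ℝ) (c : ℝ) :
    ‖∑ m ∈ range n, fourierExp (f m + c)‖ = ‖∑ m ∈ range n, fourierExp (f m)‖ := by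
  simp_rw [fourierExp_add]
  rw [← sum_mul, norm_mul, norm_fourierExp, mul_one]

lemma norm_sum_fourierExp_neg (n : ℕ) (f : ℕ → ℝ) :
    ‖∑ m ∈ range n, fourierExp (-f m)‖ = ‖∑ m ∈ range n, fourierExp (f m)‖ := by
  simp_rw [fourierExp_neg]
  rw [← map_sum, Complex.norm_conj]

/-- Weyl differencing for a quadratic phase. -/
lemma norm_sum_fourierExp_quadratic_sq_le {n : ℕ} (hn : 0 < n) (α b c : ℝ) (l : ℤ) :
    ‖∑ m ∈ range n, fourierExp (l * α * (m : ℝ) ^ 2 + b * m + c)‖ ^ 2 ≤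
      2 * n + 2 * ∑ h ∈ Ico 1 n, binBound n ((2 * l.natAbs * h : ℕ) * α) := by
  refine (normSq_sum_range _ n).trans ?_
  rw [range_eq_Ico, sum_eq_sum_Ico_succ_bot hn, mul_add]
  gcongr with h hh
  · refine (norm_sum_le _ _).trans ?_
    simp [norm_fourierExp]
  · have hphase : ∀ m : ℕ,
        fourierExp (l * α * ((m + h : ℕ) : ℝ) ^ 2 + b * (m + h : ℕ) + c) *
          (starRingEnd ℂ) (fourierExp (l * α * (m : ℝ) ^ 2 + b * m + c)) =
        fourierExp (m * (2 * l * h * α) + (l * α * h ^ 2 + b * h)) := by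
      intro m
      rw [← fourierExp_neg, ← fourierExp_add]
      congr 1
      push_cast
      ring
    simp_rw [hphase]
    rw [norm_sum_fourierExp_sub_const]
    rcases Int.natAbs_eq l with hl | hl
    · have : (l : ℝ) = (l.natAbs : ℝ) := by rw [← Int.cast_natCast, ← hl]
      refine le_trans (le_of_eq ?_) (norm_sum_fourierExp_le_binBound hn (Nat.sub_le n h) _)
      push_cast
      rw [this]
    · have : (l : ℝ) = -(l.natAbs : ℝ) := by
        rw [← Int.cast_natCast, ← Int.cast_neg, ← hl]
      rw [← norm_sum_fourierExp_neg]
      refine le_trans (le_of_eq ?_) (norm_sum_fourierExp_le_binBound hn (Nat.sub_le n h) _)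
      push_cast
      rw [this]
      congr 1
      refine sum_congr rfl fun m _ => ?_
      congr 1
      ring

lemma fractBin_injOn {n : ℕ} (hn : 0 < n) {α : ℝ} {H : ℕ}
    (hsep : ∀ d : ℕ, 0 < d → d < H → ∀ p : ℤ, 1 / (n : ℝ) ≤ |(d : ℝ) * α - p|) (j₀ : ℕ) :
    Set.InjOn (fun j : ℕ => fractBin n (j * α)) (Ico j₀ (j₀ + H) : Finset ℕ) := by
  have hn' : (0 : ℝ) < n := by exact_mod_cast hn
  have main : ∀ i j : ℕ, i < j → j < i + H → fractBin n (i * α) ≠ fractBin n (j * α) := by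
    intro i j hij hjH he
    have h := hsep (j - i) (by omega) (by omega) (⌊(j : ℝ) * α⌋ - ⌊(i : ℝ) * α⌋)
    have e : ((j - i : ℕ) : ℝ) * α - ((⌊(j : ℝ) * α⌋ - ⌊(i : ℝ) * α⌋ : ℤ) : ℝ) =
        Int.fract ((j : ℝ) * α) - Int.fract ((i : ℝ) * α) := by
      rw [← Int.self_sub_floor, ← Int.self_sub_floor, Nat.cast_sub hij.le]
      push_cast
      ring
    rw [e, div_le_iff₀ hn'] at h
    have hi0 := Int.fract_nonneg ((i : ℝ) * α)
    have hj0 := Int.fract_nonneg ((j : ℝ) * α)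
    have hi1 : (fractBin n (i * α) : ℝ) ≤ n * Int.fract ((i : ℝ) * α) :=
      Nat.floor_le (by positivity)
    have hj1 : (fractBin n (j * α) : ℝ) ≤ n * Int.fract ((j : ℝ) * α) :=
      Nat.floor_le (by positivity)
    have hi2 : n * Int.fract ((i : ℝ) * α) < fractBin n (i * α) + 1 := Nat.lt_floor_add_one _
    have hj2 : n * Int.fract ((j : ℝ) * α) < fractBin n (j * α) + 1 := Nat.lt_floor_add_one _
    rw [he] at hi1 hi2
    rcases abs_cases (Int.fract ((j : ℝ) * α) - Int.fract ((i : ℝ) * α)) with h' | h' <;>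
      rw [h'.1] at h <;> linarith
  intro i hi j hj hij
  simp only [coe_Ico, Set.mem_Ico] at hi hj
  by_contra hne
  rcases lt_or_gt_of_ne hne with h | h
  · exact main i j h (by omega) hij
  · exact main j i h (by omega) hij.symm

lemma sum_range_div_add_one_le (n : ℕ) :
    ∑ b ∈ range n, ((n : ℝ) / ((b : ℝ) + 1)) ≤ n * (1 + Real.log n) := by
  have h := harmonic_le_one_add_log n
  simp_rw [div_eq_mul_inv]
  rw [← mul_sum]
  gcongr
  simpa [harmonic] using h

lemma sum_binBound_block_le {n : ℕ} (hn : 0 < n) {α : ℝ} {H : ℕ}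
    (hsep : ∀ d : ℕ, 0 < d → d < H → ∀ p : ℤ, 1 / (n : ℝ) ≤ |(d : ℝ) * α - p|) (j₀ : ℕ) :
    ∑ j ∈ Ico j₀ (j₀ + H), binBound n (j * α) ≤ 2 * n * (1 + Real.log n) := by
  have hn' : (0 : ℝ) < n := by exact_mod_cast hn
  set G : ℕ → ℝ := fun b => n / ((b : ℝ) + 1) + n / ((n : ℝ) - b) with hG
  have h1 : ∑ j ∈ Ico j₀ (j₀ + H), binBound n (j * α) =
      ∑ b ∈ (Ico j₀ (j₀ + H)).image (fun j : ℕ => fractBin n (j * α)), G b := by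
    rw [sum_image (fractBin_injOn hn hsep j₀)]
    rfl
  have h2 : (Ico j₀ (j₀ + H)).image (fun j : ℕ => fractBin n (j * α)) ⊆ range n := by
    intro b hb
    obtain ⟨j, -, rfl⟩ := mem_image.1 hb
    exact mem_range.2 (fractBin_lt hn _)
  rw [h1]
  calc _ ≤ ∑ b ∈ range n, G b := by
        refine sum_le_sum_of_subset_of_nonneg h2 fun b hb _ => ?_
        have : (b : ℝ) < n := by exact_mod_cast mem_range.1 hb
        have : (0 : ℝ) < n - b := by linarith
        positivity
    _ = 2 * ∑ b ∈ range n, ((n : ℝ) / ((b : ℝ) + 1)) := by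
        rw [hG, sum_add_distrib, two_mul]
        congr 1
        rw [← sum_range_reflect]
        refine sum_congr rfl fun b hb => ?_
        have := mem_range.1 hb
        rw [Nat.sub_sub, Nat.cast_sub (by omega)]
        congr 1
        push_cast
        ring
    _ ≤ _ := by linarith [sum_range_div_add_one_le n]

lemma sum_binBound_le {n : ℕ} (hn : 0 < n) {α : ℝ} {H : ℕ} (hH : 0 < H)
    (hsep : ∀ d : ℕ, 0 < d → d < H → ∀ p : ℤ, 1 / (n : ℝ) ≤ |(d : ℝ) * α - p|) (X : ℕ) :
    ∑ j ∈ Icc 1 X, binBound n (j * α) ≤ ((X : ℝ) / H + 1) * (2 * n * (1 + Real.log n)) := by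
  have blocks : ∀ q : ℕ, ∑ j ∈ Ico 1 (1 + q * H), binBound n (j * α) ≤
      q * (2 * n * (1 + Real.log n)) := by
    intro q
    induction q with
    | zero => simp
    | succ q ih =>
      have e : 1 + (q + 1) * H = (1 + q * H) + H := by ring
      rw [e, ← sum_Ico_consecutive _ (Nat.le_add_right 1 (q * H)) (Nat.le_add_right _ H)]
      have := sum_binBound_block_le hn hsep (1 + q * H)
      push_cast
      linarith
  have hlog : 0 ≤ Real.log n := Real.log_natCast_nonneg n
  calc _ ≤ ∑ j ∈ Ico 1 (1 + (X / H + 1) * H), binBound n (j * α) := by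
        refine sum_le_sum_of_subset_of_nonneg ?_ fun _ _ _ => binBound_nonneg hn _
        intro j hj
        have h := mem_Icc.1 hj
        have h' : X < (X / H + 1) * H := by
          have := Nat.lt_div_mul_add (a := X) hH
          linarith
        exact mem_Ico.2 ⟨h.1, by omega⟩
    _ ≤ _ := blocks _
    _ ≤ _ := by
        gcongr
        push_cast
        gcongr
        exact Nat.cast_div_le

lemma exists_card_divisors_le_rpow {ε : ℝ} (hε : 0 < ε) :
    ∃ C : ℝ, 1 ≤ C ∧ ∀ j : ℕ, j ≠ 0 → (#j.divisors : ℝ) ≤ C * (j : ℝ) ^ ε := by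
  obtain ⟨M, hM⟩ := exists_nat_ge ((2 : ℝ) ^ (1 / ε))
  obtain ⟨K, hK1, hK⟩ : ∃ K : ℝ, 1 ≤ K ∧ ∀ a : ℕ, (a : ℝ) + 1 ≤ K * ((2 : ℝ) ^ ε) ^ a := by
    have hlog : 0 < Real.log 2 := Real.log_pos (by norm_num)
    refine ⟨max 1 (1 / (ε * Real.log 2)), le_max_left _ _, fun a => ?_⟩
    have h1 : 1 + a * (ε * Real.log 2) ≤ ((2 : ℝ) ^ ε) ^ a := by
      rw [Real.rpow_def_of_pos (by norm_num), ← Real.exp_nat_mul]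
      have := Real.add_one_le_exp (a * (Real.log 2 * ε))
      linarith
    set K := max 1 (1 / (ε * Real.log 2))
    have hk1 : (1 : ℝ) ≤ K := le_max_left _ _
    have hk2 : 1 ≤ K * (ε * Real.log 2) := by
      rw [← div_le_iff₀ (by positivity)]
      exact le_max_right _ _
    have ha : (0 : ℝ) ≤ a := a.cast_nonneg
    nlinarith
  refine ⟨K ^ M, one_le_pow₀ hK1, fun j hj => ?_⟩
  have hfac : ∏ p ∈ j.primeFactors, p ^ j.factorization p = j :=
    Nat.prod_factorization_pow_eq_self hj
  have hpow : (j : ℝ) ^ ε = ∏ p ∈ j.primeFactors, ((p : ℝ) ^ ε) ^ j.factorization p := by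
    conv_lhs => rw [← hfac]
    push_cast
    rw [← Real.finsetProd_rpow _ _ (fun _ _ => by positivity)]
    refine prod_congr rfl fun p _ => ?_
    rw [← Real.rpow_natCast, ← Real.rpow_mul (by positivity), ← Real.rpow_natCast,
      ← Real.rpow_mul (by positivity), mul_comm]
  rw [Nat.card_divisors hj, hpow]
  push_cast
  calc ∏ p ∈ j.primeFactors, ((j.factorization p : ℝ) + 1)
      ≤ ∏ p ∈ j.primeFactors,
          ((if p < M then K else 1) * ((p : ℝ) ^ ε) ^ j.factorization p) := by
        refine prod_le_prod (fun _ _ => by positivity) fun p hp => ?_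
        have hp2 : (2 : ℝ) ≤ p := by exact_mod_cast (Nat.prime_of_mem_primeFactors hp).two_le
        split_ifs with h
        · refine (hK _).trans ?_
          gcongr
        · have hMp : (2 : ℝ) ^ (1 / ε) ≤ p := hM.trans (by exact_mod_cast not_lt.1 h)
          have h2 : (2 : ℝ) ≤ (p : ℝ) ^ ε := by
            have := Real.rpow_le_rpow (by positivity) hMp hε.le
            rwa [← Real.rpow_mul (by norm_num), one_div_mul_cancel hε.ne', Real.rpow_one] at this
          rw [one_mul]
          calc ((j.factorization p : ℝ) + 1) ≤ 2 ^ j.factorization p := by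
                exact_mod_cast Nat.lt_two_pow_self
            _ ≤ _ := by gcongr
    _ = (∏ p ∈ j.primeFactors, if p < M then K else 1) *
          ∏ p ∈ j.primeFactors, ((p : ℝ) ^ ε) ^ j.factorization p := prod_mul_distrib
    _ ≤ _ := by
        gcongr
        rw [prod_ite, prod_const_one, mul_one, prod_const]
        refine pow_le_pow_right₀ hK1 ?_
        calc _ ≤ #(range M) := card_le_card fun p hp => mem_range.2 (mem_filter.1 hp).2
          _ = M := card_range M

lemma sum_binBound_mul_le {n L : ℕ} (hn : 0 < n) (α : ℝ) {D : ℝ}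
    (hD : ∀ j ∈ Icc 1 (2 * L * n), (#j.divisors : ℝ) ≤ D) :
    ∑ l ∈ Icc 1 L, ∑ h ∈ Ico 1 n, binBound n ((2 * l * h : ℕ) * α) ≤
      D * ∑ j ∈ Icc 1 (2 * L * n), binBound n (j * α) := by
  have hmaps : ∀ p ∈ Icc 1 L ×ˢ Ico 1 n, 2 * p.1 * p.2 ∈ Icc 1 (2 * L * n) := by
    rintro ⟨l, h⟩ hp
    simp only [mem_product, mem_Icc, mem_Ico] at hp ⊢
    obtain ⟨⟨h1, h2⟩, h3, h4⟩ := hp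
    refine ⟨?_, by gcongr⟩
    have : 0 < 2 * l * h := by positivity
    omega
  rw [← sum_product',
    ← sum_fiberwise_of_maps_to' hmaps (fun j : ℕ => binBound n (j * α)), mul_sum]
  refine sum_le_sum fun j hj => ?_
  rw [sum_const, nsmul_eq_mul]
  refine mul_le_mul_of_nonneg_right (le_trans ?_ (hD j hj)) (binBound_nonneg hn _)
  have hj0 : j ≠ 0 := by have := (mem_Icc.1 hj).1; omega
  norm_cast
  refine card_le_card_of_injOn Prod.fst ?_ ?_
  · rintro ⟨l, h⟩ hp
    simp only [coe_filter, Set.mem_ofPred_eq] at hp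
    simp only [mem_coe, Nat.mem_divisors]
    exact ⟨⟨2 * h, by rw [← hp.2]; ring⟩, hj0⟩
  · rintro ⟨l, h⟩ hp ⟨l', h'⟩ hp' heq
    simp only [coe_filter, Set.mem_ofPred_eq, mem_product, mem_Icc] at hp hp'
    simp only at heq
    subst heq
    have := hp.2.trans hp'.2.symm
    rw [Nat.mul_right_inj (by omega)] at this
    rw [this]

lemma sum_Icc_natAbs (H : ℕ → ℝ) (L : ℕ) :
    ∑ l ∈ Icc (-(L : ℤ)) L, H l.natAbs = H 0 + 2 * ∑ l ∈ Icc 1 L, H l := by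
  induction L with
  | zero => simp
  | succ L ih =>
    rw [Nat.cast_add, Nat.cast_one, Icc_succ_succ, sum_union (by simp), sum_pair (by lia), ih,
      sum_Icc_succ_top (by omega)]
    have h1 : (-((L : ℤ) + 1)).natAbs = L + 1 := by omega
    have h2 : ((L : ℤ) + 1).natAbs = L + 1 := by omega
    rw [h1, h2]
    ring

/-- The sum of the norms of the nontrivial exponential sums of length `n` with frequencies at most
`L` along a sequence in the plane. -/
noncomputable def expSumError (x y : ℕ → ℝ) (n L : ℕ) : ℝ :=
  ∑ p ∈ (Icc (-(L : ℤ)) L ×ˢ Icc (-(L : ℤ)) L).erase (0, 0),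
    ‖∑ m ∈ range n, fourierExp (p.1 * x m + p.2 * y m)‖

lemma norm_sum_fourierExp_linear_le {α c κ : ℝ} (hκ : 0 ≤ κ) (hc : 0 < c)
    (hdio : ∀ q : ℕ, 0 < q → ∀ p : ℤ, c / (q : ℝ) ^ κ ≤ |(q : ℝ) * α - (p : ℝ)|)
    (n L q : ℕ) (hq : 0 < q) (hqL : q ≤ L) (b : ℝ) :
    ‖∑ m ∈ range n, fourierExp (m * (q * α) + b)‖ ≤ (L : ℝ) ^ κ / (2 * c) := by
  rw [norm_sum_fourierExp_sub_const]
  have h := norm_sum_fourierExp_mul_min_fract_le n ((q : ℝ) * α)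
  have hq' : (0 : ℝ) < (q : ℝ) ^ κ := by positivity
  have h1 := hdio q hq ⌊(q : ℝ) * α⌋
  have h2 := hdio q hq (⌊(q : ℝ) * α⌋ + 1)
  have h0 := Int.fract_nonneg ((q : ℝ) * α)
  have h3 := Int.fract_lt_one ((q : ℝ) * α)
  rw [Int.self_sub_floor, abs_of_nonneg h0] at h1
  push_cast at h2
  rw [← sub_sub, Int.self_sub_floor, abs_of_nonpos (by linarith), neg_sub] at h2
  have h4 := le_min h1 h2
  have h5 := mul_le_mul_of_nonneg_left h4
    (norm_nonneg (∑ m ∈ range n, fourierExp (m * ((q : ℝ) * α))))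
  have hL : (q : ℝ) ^ κ ≤ (L : ℝ) ^ κ := by gcongr
  have h6 : ‖∑ m ∈ range n, fourierExp (m * ((q : ℝ) * α))‖ ≤ (q : ℝ) ^ κ / (2 * c) := by
    rw [le_div_iff₀ (by positivity)]
    have h7 : ‖∑ m ∈ range n, fourierExp (m * ((q : ℝ) * α))‖ * (c / (q : ℝ) ^ κ) * 2 ≤ 1 := by
      linarith
    generalize ‖∑ m ∈ range n, fourierExp (m * ((q : ℝ) * α))‖ = S at *
    calc _ = S * (c / (q : ℝ) ^ κ) * 2 * (q : ℝ) ^ κ := by field_simp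
      _ ≤ 1 * (q : ℝ) ^ κ := by gcongr
      _ = _ := one_mul _
  exact h6.trans (by gcongr)

lemma expSumError_le {α c κ : ℝ} (β γ : ℝ) (hκ : 0 ≤ κ) (hc : 0 < c)
    (hdio : ∀ q : ℕ, 0 < q → ∀ p : ℤ, c / (q : ℝ) ^ κ ≤ |(q : ℝ) * α - (p : ℝ)|)
    {n : ℕ} (hn : 0 < n) (L : ℕ) :
    expSumError (fun m => 2 * α * (m + 1 : ℕ) + β)
      (fun m => α * ((m + 1 : ℕ) : ℝ) ^ 2 + β * (m + 1 : ℕ) + γ) n L ≤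
    (2 * L + 1) * (((2 * L : ℕ) : ℝ) ^ κ / (2 * c) + 2 * ∑ l ∈ Icc 1 L,
      √(2 * n + 2 * ∑ h ∈ Ico 1 n, binBound n ((2 * l * h : ℕ) * α))) := by
  set C := ((2 * L : ℕ) : ℝ) ^ κ / (2 * c) with hC
  have hC0 : 0 ≤ C := by positivity
  set B : ℕ → ℝ := fun l => 2 * n + 2 * ∑ h ∈ Ico 1 n, binBound n ((2 * l * h : ℕ) * α) with hB
  set x : ℕ → ℝ := fun m => 2 * α * (m + 1 : ℕ) + β with hx
  set y : ℕ → ℝ := fun m => α * ((m + 1 : ℕ) : ℝ) ^ 2 + β * (m + 1 : ℕ) + γ with hy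
  have hquad : ∀ k l : ℤ, ‖∑ m ∈ range n, fourierExp (k * x m + l * y m)‖ ≤ √(B l.natAbs) := by
    intro k l
    refine Real.le_sqrt_of_sq_le ?_
    refine le_trans (le_of_eq ?_) (norm_sum_fourierExp_quadratic_sq_le hn α
      (2 * l * α + l * β + 2 * k * α) (k * (2 * α + β) + l * (α + β + γ)) l)
    congr 2
    refine sum_congr rfl fun m _ => ?_
    congr 1
    simp only [hx, hy]
    push_cast
    ring
  have hlin : ∀ k ∈ Icc (-(L : ℤ)) L, k ≠ 0 →
      ‖∑ m ∈ range n, fourierExp (k * x m + (0 : ℤ) * y m)‖ ≤ C := by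
    intro k hk hk0
    have hk' := mem_Icc.1 hk
    have key := norm_sum_fourierExp_linear_le hκ hc hdio n (2 * L) (2 * k.natAbs) (by omega)
      (by omega)
    rcases Int.natAbs_eq k with hl | hl
    · have e : (k : ℝ) = (k.natAbs : ℝ) := by rw [← Int.cast_natCast, ← hl]
      refine le_trans (le_of_eq ?_) (key (k * (2 * α + β)))
      congr 1
      refine sum_congr rfl fun m _ => ?_
      congr 1
      simp only [hx]
      push_cast
      rw [← e]
      ring
    · have e : (k.natAbs : ℝ) = -(k : ℝ) := by
        rw [← Int.cast_natCast, ← Int.cast_neg]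
        congr 1
        omega
      rw [← norm_sum_fourierExp_neg]
      refine le_trans (le_of_eq ?_) (key (-(k * (2 * α + β))))
      congr 1
      refine sum_congr rfl fun m _ => ?_
      congr 1
      simp only [hx]
      push_cast
      rw [e]
      ring
  have hcard : #(Icc (-(L : ℤ)) L) = 2 * L + 1 := by
    rw [Int.card_Icc]; omega
  unfold expSumError
  calc _ = ∑ p ∈ Icc (-(L : ℤ)) L ×ˢ Icc (-(L : ℤ)) L, if p = (0, 0) then 0 else
            ‖∑ m ∈ range n, fourierExp (p.1 * x m + p.2 * y m)‖ := by
        exact Eq.trans (sum_congr rfl fun p hp => (if_neg (mem_erase.1 hp).1).symm)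
          (sum_erase _ (if_pos rfl))
    _ ≤ ∑ p ∈ Icc (-(L : ℤ)) L ×ˢ Icc (-(L : ℤ)) L,
          (if p.2.natAbs = 0 then C else √(B p.2.natAbs)) := by
        refine sum_le_sum fun p hp => ?_
        obtain ⟨k, l⟩ := p
        have hk := (mem_product.1 hp).1
        by_cases hl : l = 0
        · subst hl
          by_cases hk0 : k = 0
          · simp [hk0, hC0]
          · simpa [hk0] using hlin k hk hk0
        · simpa [hl] using hquad k l
    _ = (2 * L + 1) * ∑ l ∈ Icc (-(L : ℤ)) L,
          (if l.natAbs = 0 then C else √(B l.natAbs)) := by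
        rw [sum_product]
        simp only [sum_const, hcard, nsmul_eq_mul]
        push_cast
        ring
    _ = _ := by
        rw [sum_Icc_natAbs (fun j => if j = 0 then C else √(B j))]
        congr 2
        congr 1
        refine sum_congr rfl fun l hl => ?_
        rw [if_neg (by have := (mem_Icc.1 hl).1; omega)]

lemma sum_sqrt_le (L : ℕ) (B : ℕ → ℝ) (hB : ∀ l, 0 ≤ B l) :
    ∑ l ∈ Icc 1 L, √(B l) ≤ √(L * ∑ l ∈ Icc 1 L, B l) := by
  refine Real.le_sqrt_of_sq_le ?_
  refine sq_sum_le_card_mul_sum_sq.trans ?_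
  simp [Real.sq_sqrt (hB _)]

lemma exists_sum_binBound_le_rpow {α c κ ε : ℝ} (hκ : 1 ≤ κ) (hc : 0 < c) (hε : 0 < ε)
    (hdio : ∀ q : ℕ, 0 < q → ∀ p : ℤ, c / (q : ℝ) ^ κ ≤ |(q : ℝ) * α - (p : ℝ)|) :
    ∃ C : ℝ, 0 < C ∧ ∃ n₀ : ℕ, ∀ n : ℕ, n₀ ≤ n → ∀ X : ℕ, ∑ j ∈ Icc 1 X, binBound n (j * α) ≤
      C * (X + n) * (n : ℝ) ^ (1 - 1 / κ + ε) := by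
  have hκ0 : 0 < κ := by linarith
  obtain ⟨n₀, hn₀⟩ := exists_nat_ge (max 1 (1 / c))
  refine ⟨(2 / c ^ (1 / κ) + 1) * (2 * (1 + 1 / ε)), by positivity, n₀, fun n hn X => ?_⟩
  have hnn : max 1 (1 / c) ≤ (n : ℝ) := hn₀.trans (by exact_mod_cast hn)
  have hn1 : (1 : ℝ) ≤ n := (le_max_left _ _).trans hnn
  have hnc : 1 ≤ c * n := by
    have := (le_max_right _ _).trans hnn
    rw [div_le_iff₀ hc] at this
    linarith
  have hn0 : 0 < n := by exact_mod_cast (by linarith : (0 : ℝ) < n)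
  set Y := (c * n : ℝ) ^ (1 / κ) with hY
  have hY1 : 1 ≤ Y := Real.one_le_rpow hnc (by positivity)
  set H := ⌊Y⌋₊ with hH
  have hH0 : 0 < H := Nat.floor_pos.2 hY1
  have hH1 : (1 : ℝ) ≤ H := by exact_mod_cast hH0
  have hHY : (H : ℝ) ≤ Y := Nat.floor_le (by linarith)
  have hHY2 : Y / 2 ≤ H := by
    have := Nat.lt_floor_add_one Y
    rw [← hH] at this
    linarith
  have hYk : Y ^ κ = c * n := by
    rw [hY, ← Real.rpow_mul (by linarith), one_div_mul_cancel hκ0.ne', Real.rpow_one]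
  have hsep : ∀ d : ℕ, 0 < d → d < H → ∀ p : ℤ, 1 / (n : ℝ) ≤ |(d : ℝ) * α - p| := by
    intro d hd hdH p
    refine le_trans ?_ (hdio d hd p)
    have hd' : (0 : ℝ) < d := by exact_mod_cast hd
    have : (d : ℝ) ^ κ ≤ c * n := by
      rw [← hYk]
      refine Real.rpow_le_rpow hd'.le (le_trans ?_ hHY) hκ0.le
      exact_mod_cast hdH.le
    rw [div_le_div_iff₀ (by positivity) (by positivity)]
    linarith
  have hlog : 1 + Real.log n ≤ (1 + 1 / ε) * (n : ℝ) ^ ε := by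
    have h1 := Real.log_natCast_le_rpow_div n hε
    have h2 : 1 ≤ (n : ℝ) ^ ε := Real.one_le_rpow hn1 hε.le
    calc _ ≤ (n : ℝ) ^ ε + (n : ℝ) ^ ε / ε := add_le_add h2 h1
      _ = _ := by ring
  refine (sum_binBound_le hn0 hH0 hsep X).trans ?_
  have hn' : (0 : ℝ) < n := by linarith
  have hblocks : (X : ℝ) / H + 1 ≤ (2 / c ^ (1 / κ) + 1) * (X + n) * (n : ℝ) ^ (-(1 / κ)) := by
    have hYn : Y = c ^ (1 / κ) * (n : ℝ) ^ (1 / κ) := Real.mul_rpow hc.le hn'.le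
    have h1 : (X : ℝ) / H ≤ X / (Y / 2) := by gcongr
    have h2 : (X : ℝ) / (Y / 2) = 2 / c ^ (1 / κ) * X * (n : ℝ) ^ (-(1 / κ)) := by
      rw [hYn, Real.rpow_neg hn'.le]
      field_simp
    have h3 : 1 ≤ n * (n : ℝ) ^ (-(1 / κ)) := by
      nth_rewrite 1 [← Real.rpow_one (n : ℝ)]
      rw [← Real.rpow_add hn']
      refine Real.one_le_rpow hn1 ?_
      have : 1 / κ ≤ 1 := by rw [div_le_one hκ0]; exact hκ
      linarith
    have h4 : (0 : ℝ) ≤ (n : ℝ) ^ (-(1 / κ)) := by positivity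
    have h5 : 0 ≤ 2 / c ^ (1 / κ) := by positivity
    have h6 : (0 : ℝ) ≤ X := X.cast_nonneg
    have h7 := mul_nonneg h5 (mul_nonneg hn'.le h4)
    have h8 := mul_nonneg h6 h4
    calc _ ≤ 2 / c ^ (1 / κ) * X * (n : ℝ) ^ (-(1 / κ)) + n * (n : ℝ) ^ (-(1 / κ)) := by linarith
      _ ≤ _ := by nlinarith
  calc _ ≤ ((2 / c ^ (1 / κ) + 1) * (X + n) * (n : ℝ) ^ (-(1 / κ))) *
        (2 * n * ((1 + 1 / ε) * (n : ℝ) ^ ε)) := by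
        gcongr
    _ = (2 / c ^ (1 / κ) + 1) * (2 * (1 + 1 / ε)) * (X + n) *
        ((n : ℝ) ^ (1 : ℝ) * (n : ℝ) ^ (-(1 / κ)) * (n : ℝ) ^ ε) := by
        rw [Real.rpow_one]; ring
    _ = _ := by
        rw [← Real.rpow_add hn', ← Real.rpow_add hn', sub_eq_add_neg]

lemma exists_expSumError_le_rpow {α c κ ν : ℝ} (β γ : ℝ) (hκ : 1 ≤ κ) (hc : 0 < c)
    (hdio : ∀ q : ℕ, 0 < q → ∀ p : ℤ, c / (q : ℝ) ^ κ ≤ |(q : ℝ) * α - (p : ℝ)|)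
    (hν0 : 0 < ν) (hν : ν < 1 / (4 * κ)) (A : ℝ) (hA : 1 ≤ A) :
    ∃ C τ : ℝ, 0 < C ∧ 0 < τ ∧ ∃ n₀ : ℕ, ∀ n : ℕ, n₀ ≤ n → ∀ L : ℕ, 1 ≤ L →
      (L : ℝ) ≤ A * (n : ℝ) ^ ν →
      expSumError (fun m => 2 * α * (m + 1 : ℕ) + β)
        (fun m => α * ((m + 1 : ℕ) : ℝ) ^ 2 + β * (m + 1 : ℕ) + γ) n L ≤
      C * (n : ℝ) ^ (1 - τ) := by
  have hκ0 : 0 < κ := by linarith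
  have hν4 : ν * (4 * κ) < 1 := (lt_div_iff₀ (by positivity)).1 hν
  have hν1 : ν < 1 / 4 := by nlinarith
  have hik : 1 / κ ≤ 1 := by rw [div_le_one hκ0]; exact hκ
  have h4k : 1 / (4 * κ) = (1 / κ) / 4 := by field_simp
  set τ := (1 / κ / 2 - 2 * ν) / 2 with hτ
  have hτ0 : 0 < τ := by rw [h4k] at hν; linarith
  set ε := 2 * τ / 3 with hε
  have hε0 : 0 < ε := by positivity
  obtain ⟨C₁, hC₁, n₁, hn₁⟩ := exists_sum_binBound_le_rpow hκ hc hε0 hdio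
  obtain ⟨C₂, hC₂, hdiv⟩ := exists_card_divisors_le_rpow hε0
  set C₃ := C₂ * (2 * A) ^ ε with hC₃
  set C₄ := 2 + 6 * C₃ * C₁ with hC₄
  have hA0 : 0 < A := by linarith
  have hC₃0 : 0 < C₃ := by positivity
  have hC₄0 : 0 < C₄ := by positivity
  refine ⟨3 * A * ((2 * A) ^ κ / (2 * c) + 2 * (A * √C₄)), τ, by positivity, hτ0, max n₁ 1,
    fun n hn L hL1 hL => ?_⟩
  have hn1 : 1 ≤ n := (le_max_right _ _).trans hn
  have hn1' : (1 : ℝ) ≤ n := by exact_mod_cast hn1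
  have hn' : (0 : ℝ) < n := by linarith
  have hL' : (1 : ℝ) ≤ L := by exact_mod_cast hL1
  have hnν : (n : ℝ) ^ ν ≤ n := by
    conv_rhs => rw [← Real.rpow_one (n : ℝ)]
    exact Real.rpow_le_rpow_of_exponent_le hn1' (by linarith)
  have hD : ∀ j ∈ Icc 1 (2 * L * n), (#j.divisors : ℝ) ≤ C₃ * (n : ℝ) ^ (2 * ε) := by
    intro j hj
    have hj' := mem_Icc.1 hj
    have hjle : (j : ℝ) ≤ 2 * A * (n : ℝ) ^ (2 : ℝ) := by
      calc (j : ℝ) ≤ 2 * L * n := by exact_mod_cast hj'.2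
        _ ≤ 2 * (A * n) * n := by gcongr; exact hL.trans (by gcongr)
        _ = _ := by rw [Real.rpow_two]; ring
    calc _ ≤ C₂ * (j : ℝ) ^ ε := hdiv j (by omega)
      _ ≤ C₂ * (2 * A * (n : ℝ) ^ (2 : ℝ)) ^ ε := by gcongr
      _ = _ := by
        rw [Real.mul_rpow (by positivity) (by positivity), ← Real.rpow_mul hn'.le, hC₃]
        ring
  set B : ℕ → ℝ := fun l => 2 * n + 2 * ∑ h ∈ Ico 1 n, binBound n ((2 * l * h : ℕ) * α) with hB
  have hB0 : ∀ l, 0 ≤ B l := fun l => by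
    have := sum_nonneg fun h (_ : h ∈ Ico 1 n) => binBound_nonneg hn1 ((2 * l * h : ℕ) * α)
    simp only [hB]
    positivity
  have hBsum : ∑ l ∈ Icc 1 L, B l ≤ C₄ * L * (n : ℝ) ^ (2 - 1 / κ + 3 * ε) := by
    have h1 := sum_binBound_mul_le hn1 α hD
    have h2 := hn₁ n ((le_max_left _ _).trans hn) (2 * L * n)
    have h3 : (((2 * L * n : ℕ) : ℝ) + n) ≤ 3 * L * n := by
      push_cast
      nlinarith
    have h4 : (n : ℝ) ≤ (n : ℝ) ^ (2 - 1 / κ + 3 * ε) := by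
      nth_rewrite 1 [← Real.rpow_one (n : ℝ)]
      exact Real.rpow_le_rpow_of_exponent_le hn1' (by linarith)
    have h5 : (n : ℝ) ^ (2 - 1 / κ + 3 * ε) =
        (n : ℝ) ^ (2 * ε) * (n * (n : ℝ) ^ (1 - 1 / κ + ε)) := by
      nth_rewrite 3 [← Real.rpow_one (n : ℝ)]
      rw [← Real.rpow_add hn', ← Real.rpow_add hn']
      congr 1
      ring
    calc ∑ l ∈ Icc 1 L, B l
        = 2 * L * n + 2 * ∑ l ∈ Icc 1 L, ∑ h ∈ Ico 1 n, binBound n ((2 * l * h : ℕ) * α) := by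
          simp only [hB, sum_add_distrib, ← mul_sum]
          simp
          ring
      _ ≤ 2 * L * n + 2 * (C₃ * (n : ℝ) ^ (2 * ε) *
            (C₁ * (3 * L * n) * (n : ℝ) ^ (1 - 1 / κ + ε))) := by
          gcongr
          refine h1.trans ?_
          gcongr
          refine h2.trans ?_
          gcongr
      _ = 2 * L * n + 6 * C₃ * C₁ * L * (n : ℝ) ^ (2 - 1 / κ + 3 * ε) := by
          rw [h5]; ring
      _ ≤ 2 * L * (n : ℝ) ^ (2 - 1 / κ + 3 * ε) +
            6 * C₃ * C₁ * L * (n : ℝ) ^ (2 - 1 / κ + 3 * ε) := by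
          gcongr
      _ = _ := by rw [hC₄]; ring
  have hsqrt : ∑ l ∈ Icc 1 L, √(B l) ≤ A * √C₄ * (n : ℝ) ^ (1 - τ - ν) := by
    refine (sum_sqrt_le L B hB0).trans ?_
    rw [← Real.sqrt_sq (by positivity : 0 ≤ A * √C₄ * (n : ℝ) ^ (1 - τ - ν))]
    refine Real.sqrt_le_sqrt ?_
    rw [mul_pow, mul_pow, Real.sq_sqrt hC₄0.le, ← Real.rpow_natCast ((n : ℝ) ^ _),
      ← Real.rpow_mul hn'.le]
    calc _ ≤ (L : ℝ) * (C₄ * L * (n : ℝ) ^ (2 - 1 / κ + 3 * ε)) := by gcongr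
      _ = (L : ℝ) ^ 2 * (C₄ * (n : ℝ) ^ (2 - 1 / κ + 3 * ε)) := by ring
      _ ≤ (A * (n : ℝ) ^ ν) ^ 2 * (C₄ * (n : ℝ) ^ (2 - 1 / κ + 3 * ε)) := by gcongr
      _ = A ^ 2 * C₄ * ((n : ℝ) ^ (ν * 2) * (n : ℝ) ^ (2 - 1 / κ + 3 * ε)) := by
        rw [mul_pow, ← Real.rpow_natCast ((n : ℝ) ^ ν), ← Real.rpow_mul hn'.le]
        push_cast
        ring
      _ = _ := by
        rw [← Real.rpow_add hn']
        congr 2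
        simp only [hε, hτ]
        push_cast
        ring
  have hlin : ((2 * L : ℕ) : ℝ) ^ κ / (2 * c) ≤ (2 * A) ^ κ / (2 * c) * (n : ℝ) ^ (1 - τ - ν) := by
    rw [div_mul_eq_mul_div]
    gcongr
    calc ((2 * L : ℕ) : ℝ) ^ κ ≤ (2 * A * (n : ℝ) ^ ν) ^ κ := by
          push_cast
          rw [mul_assoc]
          gcongr
      _ = (2 * A) ^ κ * (n : ℝ) ^ (ν * κ) := by
          rw [Real.mul_rpow (by positivity) (by positivity), ← Real.rpow_mul hn'.le]
      _ ≤ _ := by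
          gcongr
          linarith
  refine (expSumError_le β γ hκ0.le hc hdio hn1 L).trans ?_
  calc _ ≤ (3 * (A * (n : ℝ) ^ ν)) * ((2 * A) ^ κ / (2 * c) * (n : ℝ) ^ (1 - τ - ν) +
        2 * (A * √C₄ * (n : ℝ) ^ (1 - τ - ν))) := by
        gcongr
        linarith
    _ = 3 * A * ((2 * A) ^ κ / (2 * c) + 2 * (A * √C₄)) *
        ((n : ℝ) ^ ν * (n : ℝ) ^ (1 - τ - ν)) := by ring
    _ = _ := by
        rw [← Real.rpow_add hn']
        congr 2
        ring

/-- `f` is a trigonometric polynomial of degree at most `L` with coefficients bounded by `B` and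
constant term `c₀`. -/
def IsTrigPoly (f : ℝ → ℝ) (L : ℕ) (B c₀ : ℝ) : Prop :=
  ∃ c : ℤ → ℂ, (∀ k, ‖c k‖ ≤ B) ∧ c 0 = c₀ ∧
    ∀ x, (f x : ℂ) = ∑ k ∈ Icc (-(L : ℤ)) L, c k * fourierExp (k * x)

lemma IsTrigPoly.abs_sum_sub_le {f g : ℝ → ℝ} {L : ℕ} {B B' c₀ d₀ : ℝ}
    (hf : IsTrigPoly f L B c₀) (hg : IsTrigPoly g L B' d₀) (x y : ℕ → ℝ) (n : ℕ) :
    |∑ m ∈ range n, f (x m) * g (y m) - n * (c₀ * d₀)| ≤ B * B' * expSumError x y n L := by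
  obtain ⟨c, hcB, hc0, hf⟩ := hf
  obtain ⟨d, hdB, hd0, hg⟩ := hg
  have hB : 0 ≤ B := (norm_nonneg _).trans (hcB 0)
  set box := Icc (-(L : ℤ)) L ×ˢ Icc (-(L : ℤ)) L with hbox
  have h0 : ((0 : ℤ), (0 : ℤ)) ∈ box := by simp [hbox]
  have hsum : ((∑ m ∈ range n, f (x m) * g (y m) : ℝ) : ℂ) =
      ∑ p ∈ box, c p.1 * d p.2 * ∑ m ∈ range n, fourierExp (p.1 * x m + p.2 * y m) := by
    simp_rw [mul_sum]
    rw [sum_comm, Complex.ofReal_sum]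
    refine sum_congr rfl fun m _ => ?_
    rw [Complex.ofReal_mul, hf, hg, sum_mul_sum, hbox, sum_product]
    refine sum_congr rfl fun k _ => sum_congr rfl fun l _ => ?_
    rw [fourierExp_add]
    ring
  rw [← add_sum_erase _ _ h0] at hsum
  have hdiff : ((∑ m ∈ range n, f (x m) * g (y m) - n * (c₀ * d₀) : ℝ) : ℂ) =
      ∑ p ∈ box.erase (0, 0),
        c p.1 * d p.2 * ∑ m ∈ range n, fourierExp (p.1 * x m + p.2 * y m) := by
    rw [Complex.ofReal_sub, hsum]
    simp only [hc0, hd0, Int.cast_zero, zero_mul, add_zero, fourierExp_zero, sum_const,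
      card_range, nsmul_eq_mul]
    push_cast
    ring
  rw [← Real.norm_eq_abs, ← Complex.norm_real, hdiff, expSumError, mul_sum]
  refine (norm_sum_le _ _).trans (sum_le_sum fun p _ => ?_)
  rw [norm_mul, norm_mul]
  gcongr
  · exact hcB _
  · exact hdB _

lemma isTrigPoly_of_sum {ι : Type*} (s : Finset ι) (freq : ι → ℤ) (w : ι → ℝ) {f : ℝ → ℝ}
    {L : ℕ} {B : ℝ} (hfreq : ∀ i ∈ s, freq i ∈ Icc (-(L : ℤ)) L)
    (hB : ∀ k, |∑ i ∈ s with freq i = k, w i| ≤ B)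
    (hf : ∀ x, (f x : ℂ) = ∑ i ∈ s, (w i : ℂ) * fourierExp (freq i * x)) :
    IsTrigPoly f L B (∑ i ∈ s with freq i = 0, w i) := by
  refine ⟨fun k => ((∑ i ∈ s with freq i = k, w i : ℝ) : ℂ), fun k => ?_, rfl, fun x => ?_⟩
  · rw [Complex.norm_real]
    exact hB k
  · rw [hf, ← sum_fiberwise_of_maps_to hfreq]
    refine sum_congr rfl fun k _ => ?_
    push_cast
    rw [sum_mul]
    refine sum_congr rfl fun i hi => ?_
    rw [(mem_filter.1 hi).2]

lemma expSumError_sub_const (x y : ℕ → ℝ) (a b : ℝ) (n L : ℕ) :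
    expSumError (fun m => x m - a) (fun m => y m - b) n L = expSumError x y n L := by
  unfold expSumError
  refine sum_congr rfl fun p _ => ?_
  rw [← norm_sum_fourierExp_sub_const n (fun m => p.1 * x m + p.2 * y m) (-(p.1 * a + p.2 * b))]
  congr 1
  refine sum_congr rfl fun m _ => ?_
  congr 1
  ring

/-- The trigonometric polynomial with coefficients `sin (πj/M)`, `0 ≤ j < M`. -/
noncomputable def sinePoly (M : ℕ) (x : ℝ) : ℂ :=
  ∑ j ∈ range M, (Real.sin (Real.pi / M * j) : ℂ) * fourierExp (j * x)

/-- The Fejér–Korovkin kernel, normalised to have constant term `M / 2`. -/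
noncomputable def korovkinKernel (M : ℕ) (x : ℝ) : ℝ := Complex.normSq (sinePoly M x)

lemma korovkinKernel_nonneg (M : ℕ) (x : ℝ) : 0 ≤ korovkinKernel M x := Complex.normSq_nonneg _

lemma korovkinKernel_le (M : ℕ) (x : ℝ) : korovkinKernel M x ≤ (M : ℝ) ^ 2 := by
  rw [korovkinKernel, Complex.normSq_eq_norm_sq]
  gcongr
  refine (norm_sum_le _ _).trans ?_
  calc _ ≤ ∑ j ∈ range M, (1 : ℝ) := by
        refine sum_le_sum fun j _ => ?_
        rw [norm_mul, norm_fourierExp, mul_one, Complex.norm_real]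
        exact Real.abs_sin_le_one _
    _ = M := by simp

lemma korovkinKernel_sub_intCast (M : ℕ) (x : ℝ) (k : ℤ) :
    korovkinKernel M (x - k) = korovkinKernel M x := by
  unfold korovkinKernel sinePoly
  congr 1
  refine sum_congr rfl fun j _ => ?_
  have : (j : ℝ) * (x - k) = j * x + ((-(j * k) : ℤ) : ℝ) := by push_cast; ring
  rw [this, fourierExp_add, fourierExp_intCast, mul_one]

lemma sum_sin_sq {M : ℕ} (hM : 2 ≤ M) :
    ∑ j ∈ range M, Real.sin (Real.pi / M * j) ^ 2 = M / 2 := by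
  have hM0 : (M : ℝ) ≠ 0 := by positivity
  have hroot := (Complex.isPrimitiveRoot_exp M (by omega)).geom_sum_eq_zero (by omega)
  have hexp : Complex.exp (2 * Real.pi * Complex.I / M) = fourierExp (1 / M) := by
    rw [fourierExp]
    congr 1
    push_cast
    ring
  rw [hexp] at hroot
  simp_rw [← fourierExp_natCast_mul] at hroot
  have hre := congrArg Complex.re hroot
  rw [Complex.re_sum, Complex.zero_re] at hre
  have hcos : ∑ j ∈ range M, Real.cos (2 * (Real.pi / M * j)) = 0 := by
    rw [← hre]
    refine sum_congr rfl fun j _ => ?_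
    rw [fourierExp_eq]
    simp only [Complex.add_re, Complex.ofReal_re, Complex.mul_re, Complex.I_re, mul_zero,
      Complex.ofReal_im, Complex.I_im, mul_one, sub_self, add_zero]
    congr 1
    ring
  have : ∀ j ∈ range M, Real.sin (Real.pi / M * j) ^ 2 =
      1 / 2 - Real.cos (2 * (Real.pi / M * j)) / 2 := by
    intro j _
    rw [Real.sin_sq_eq_half_sub]
  rw [sum_congr rfl this, sum_sub_distrib, ← sum_div, ← sum_div, hcos]
  simp

lemma sin_pi_div_mul_nonneg {M j : ℕ} (hj : j ≤ M) : 0 ≤ Real.sin (Real.pi / M * j) := by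
  rcases Nat.eq_zero_or_pos M with rfl | hM
  · simp
  have hM' : (0 : ℝ) < M := by exact_mod_cast hM
  have hj' : (j : ℝ) ≤ M := by exact_mod_cast hj
  refine Real.sin_nonneg_of_nonneg_of_le_pi (by positivity) ?_
  rw [div_mul_eq_mul_div, div_le_iff₀ hM']
  gcongr

lemma le_korovkinKernel {M : ℕ} (hM : 2 ≤ M) {x : ℝ} (hx : |x| ≤ 1 / (6 * M)) :
    (M : ℝ) ^ 2 / 16 ≤ korovkinKernel M x := by
  have hM0 : (0 : ℝ) < M := by positivity
  have hre : (M : ℝ) / 4 ≤ (sinePoly M x).re := by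
    unfold sinePoly
    rw [Complex.re_sum]
    calc (M : ℝ) / 4 = ∑ j ∈ range M, Real.sin (Real.pi / M * j) ^ 2 * (1 / 2) := by
          rw [← sum_mul, sum_sin_sq hM]; ring
      _ ≤ _ := by
          refine sum_le_sum fun j hj => ?_
          have hjM := mem_range.1 hj
          have hjM' : (j : ℝ) ≤ M := by exact_mod_cast hjM.le
          have h0 := sin_pi_div_mul_nonneg hjM.le
          have h1 := Real.sin_le_one (Real.pi / M * j)
          have hcos : 1 / 2 ≤ Real.cos (2 * Real.pi * (j * x)) := by
            rw [← Real.cos_pi_div_three, ← Real.cos_abs (2 * Real.pi * (j * x))]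
            refine Real.cos_le_cos_of_nonneg_of_le_pi (abs_nonneg _)
              (by linarith [Real.pi_pos]) ?_
            rw [abs_mul (2 * Real.pi), abs_mul (j : ℝ), abs_of_pos Real.two_pi_pos, Nat.abs_cast]
            calc 2 * Real.pi * (j * |x|) ≤ 2 * Real.pi * (M * (1 / (6 * M))) := by gcongr
              _ = Real.pi / 3 := by field_simp; norm_num
          rw [Complex.re_ofReal_mul, fourierExp_eq]
          simp only [Complex.add_re, Complex.ofReal_re, Complex.mul_re, Complex.I_re, mul_zero,
            Complex.ofReal_im, Complex.I_im, mul_one, sub_self, add_zero]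
          refine mul_le_mul ?_ hcos (by norm_num) h0
          nlinarith
  rw [korovkinKernel, Complex.normSq_apply]
  nlinarith [mul_self_nonneg (sinePoly M x).im]

lemma isTrigPoly_korovkinKernel {M : ℕ} (hM : 2 ≤ M) :
    IsTrigPoly (korovkinKernel M) M M (M / 2) := by
  have key := isTrigPoly_of_sum (range M ×ˢ range M) (fun p => (p.1 : ℤ) - p.2)
    (fun p => Real.sin (Real.pi / M * p.1) * Real.sin (Real.pi / M * p.2))
    (f := korovkinKernel M) (L := M) (B := M) ?_ ?_ ?_
  · convert key using 1
    rw [← sum_sin_sq hM]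
    refine sum_bij (fun j _ => (j, j)) ?_ ?_ ?_ ?_
    · intro j hj
      simpa using hj
    · intro i _ j _ h
      exact (Prod.mk.inj h).1
    · rintro ⟨i, j⟩ hp
      simp only [mem_filter, mem_product] at hp
      have : i = j := by omega
      exact ⟨i, hp.1.1, by rw [← this]⟩
    · intro j _
      ring
  · rintro ⟨i, j⟩ hp
    simp only [mem_product, mem_range, mem_Icc] at hp ⊢
    omega
  · intro k
    refine (abs_sum_le_sum_abs _ _).trans ?_
    calc _ ≤ ∑ p ∈ range M ×ˢ range M with (p.1 : ℤ) - p.2 = k, (1 : ℝ) := by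
          refine sum_le_sum fun p _ => ?_
          rw [abs_mul]
          exact mul_le_one₀ (Real.abs_sin_le_one _) (abs_nonneg _) (Real.abs_sin_le_one _)
      _ ≤ M := by
          rw [sum_const, nsmul_eq_mul, mul_one]
          norm_cast
          conv_rhs => rw [← card_range M]
          refine card_le_card_of_injOn Prod.fst ?_ ?_
          · rintro ⟨i, j⟩ hp
            simp only [coe_filter, Set.mem_ofPred_eq, mem_product] at hp
            exact hp.1.1
          · rintro ⟨i, j⟩ hp ⟨i', j'⟩ hp' heq
            simp only [coe_filter, Set.mem_ofPred_eq, mem_product] at hp hp'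
            simp only at heq
            subst heq
            obtain rfl : j = j' := by lia
            rfl
  · intro x
    rw [korovkinKernel, ← Complex.mul_conj, sinePoly, map_sum, sum_mul_sum, ← sum_product']
    refine sum_congr rfl fun p _ => ?_
    rw [map_mul, Complex.conj_ofReal, ← fourierExp_neg]
    push_cast
    rw [sub_mul, sub_eq_add_neg, fourierExp_add]
    ring

lemma sinePoly_recurrence (η : ℝ) (z : ℂ) (N : ℕ) :
    (1 + z ^ 2 - 2 * Real.cos η * z) * ∑ j ∈ range N, (Real.sin (η * j) : ℂ) * z ^ j =
      Real.sin (η * (N - 1)) * z ^ (N + 1) - Real.sin (η * N) * z ^ N + Real.sin η * z := by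
  induction N with
  | zero => simp
  | succ N ih =>
    rw [sum_range_succ, mul_add, ih]
    have h : (Real.sin (η * ((N + 1 : ℕ) : ℝ)) : ℂ) =
        2 * Real.cos η * Real.sin (η * N) - Real.sin (η * (N - 1)) := by
      have : Real.sin (η * ((N + 1 : ℕ) : ℝ)) =
          2 * Real.cos η * Real.sin (η * N) - Real.sin (η * (N - 1)) := by
        push_cast
        rw [mul_add, mul_sub, mul_one, Real.sin_add, Real.sin_sub]
        ring
      rw [this]
      push_cast
      ring
    have h' : (Real.sin (η * (((N + 1 : ℕ) : ℝ) - 1)) : ℂ) = Real.sin (η * N) := by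
      congr 3
      push_cast
      ring
    rw [h, h']
    ring

lemma two_cos_sub_mul_sinePoly {M : ℕ} (hM : 0 < M) (x : ℝ) :
    (2 * Real.cos (2 * Real.pi * x) - 2 * Real.cos (Real.pi / M) : ℂ) * sinePoly M x =
      Real.sin (Real.pi / M) * (1 + fourierExp (M * x)) := by
  have hM' : (M : ℝ) ≠ 0 := by positivity
  have hz : fourierExp x * (starRingEnd ℂ) (fourierExp x) = 1 := by
    rw [← fourierExp_neg, ← fourierExp_add, add_neg_cancel, fourierExp_zero]
  have hz0 : fourierExp x ≠ 0 := left_ne_zero_of_mul_eq_one hz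
  have hcos : (2 * Real.cos (2 * Real.pi * x) : ℂ) =
      fourierExp x + (starRingEnd ℂ) (fourierExp x) := by
    rw [Complex.add_conj, fourierExp_eq]
    simp only [Complex.add_re, Complex.ofReal_re, Complex.mul_re, Complex.I_re, mul_zero,
      Complex.ofReal_im, Complex.I_im, mul_one, sub_self, add_zero]
    push_cast
    rfl
  have h := sinePoly_recurrence (Real.pi / M) (fourierExp x) M
  have h1 : Real.sin (Real.pi / M * (M - 1)) = Real.sin (Real.pi / M) := by
    rw [mul_sub, div_mul_cancel₀ _ hM', mul_one, Real.sin_pi_sub]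
  have h2 : Real.sin (Real.pi / M * M) = 0 := by
    rw [div_mul_cancel₀ _ hM', Real.sin_pi]
  rw [h1, h2, Complex.ofReal_zero, zero_mul, sub_zero] at h
  unfold sinePoly
  simp_rw [fourierExp_natCast_mul]
  refine mul_left_cancel₀ hz0 ?_
  rw [hcos]
  generalize ∑ j ∈ range M, (Real.sin (Real.pi / M * j) : ℂ) * fourierExp x ^ j = S at *
  generalize (starRingEnd ℂ) (fourierExp x) = w at *
  generalize fourierExp x = z at *
  linear_combination h + S * hz

lemma one_add_mul_conj_sinePoly {M : ℕ} (hM : 0 < M) (x : ℝ) :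
    (1 + fourierExp (M * x)) * (starRingEnd ℂ) (sinePoly M x) =
      ∑ k ∈ Icc (-(M : ℤ)) M, (Real.sin (Real.pi / M * k.natAbs) : ℂ) * fourierExp (k * x) := by
  have hM' : (M : ℝ) ≠ 0 := by positivity
  have hconj : (starRingEnd ℂ) (sinePoly M x) =
      ∑ j ∈ range M, (Real.sin (Real.pi / M * j) : ℂ) * fourierExp (-(j * x)) := by
    unfold sinePoly
    rw [map_sum]
    refine sum_congr rfl fun j _ => ?_
    rw [map_mul, Complex.conj_ofReal, fourierExp_neg]
  have hsplit : ∀ N : ℕ, ∑ k ∈ Icc (-(N : ℤ)) N,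
      (Real.sin (Real.pi / M * k.natAbs) : ℂ) * fourierExp (k * x) =
      ∑ j ∈ range (N + 1), (Real.sin (Real.pi / M * j) : ℂ) * fourierExp (-(j * x)) +
      ∑ j ∈ range (N + 1), (Real.sin (Real.pi / M * j) : ℂ) * fourierExp (j * x) := by
    intro N
    induction N with
    | zero => simp
    | succ N ih =>
      rw [Nat.cast_add, Nat.cast_one, Icc_succ_succ, sum_union (by simp), sum_pair (by lia), ih,
        sum_range_succ _ (N + 1), sum_range_succ _ (N + 1)]
      have h1 : (-((N : ℤ) + 1)).natAbs = N + 1 := by omega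
      have h2 : ((N : ℤ) + 1).natAbs = N + 1 := by omega
      have h3 : ((-((N : ℤ) + 1) : ℤ) : ℝ) * x = -(((N + 1 : ℕ) : ℝ) * x) := by push_cast; ring
      have h4 : (((N : ℤ) + 1 : ℤ) : ℝ) * x = ((N + 1 : ℕ) : ℝ) * x := by push_cast; ring
      rw [h1, h2, h3, h4]
      ring
  have hlast : Real.sin (Real.pi / M * M) = 0 := by
    rw [div_mul_cancel₀ _ hM', Real.sin_pi]
  have hrefl : ∑ j ∈ range (M + 1), (Real.sin (Real.pi / M * j) : ℂ) * fourierExp (j * x) =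
      fourierExp (M * x) *
        ∑ j ∈ range (M + 1), (Real.sin (Real.pi / M * j) : ℂ) * fourierExp (-(j * x)) := by
    rw [← sum_range_reflect, mul_sum]
    refine sum_congr rfl fun j hj => ?_
    have hjM : j ≤ M := by have := mem_range.1 hj; omega
    have hsin : Real.sin (Real.pi / M * ((M + 1 - 1 - j : ℕ) : ℝ)) =
        Real.sin (Real.pi / M * j) := by
      rw [Nat.add_sub_cancel, Nat.cast_sub hjM, mul_sub, div_mul_cancel₀ _ hM', Real.sin_pi_sub]
    rw [hsin, Nat.add_sub_cancel, Nat.cast_sub hjM, sub_mul, sub_eq_add_neg, fourierExp_add]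
    ring
  rw [hsplit, hrefl, sum_range_succ, hlast, hconj]
  simp only [Complex.ofReal_zero, zero_mul, add_zero]
  ring

lemma isTrigPoly_korovkinKernel_mul_cos_sub {M : ℕ} (hM : 0 < M) :
    IsTrigPoly (fun x => korovkinKernel M x *
      (Real.cos (2 * Real.pi * x) - Real.cos (Real.pi / M))) M (Real.sin (Real.pi / M) / 2) 0 := by
  have hsin : 0 ≤ Real.sin (Real.pi / M) := by
    have := sin_pi_div_mul_nonneg (M := M) (j := 1) hM
    simpa using this
  refine ⟨fun k => (Real.sin (Real.pi / M) / 2 : ℝ) * Real.sin (Real.pi / M * k.natAbs),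
    fun k => ?_, by simp, fun x => ?_⟩
  · rw [norm_mul, Complex.norm_real, Complex.norm_real, Real.norm_of_nonneg (by positivity)]
    exact mul_le_of_le_one_right (by positivity) (Real.abs_sin_le_one _)
  · simp_rw [mul_assoc ((Real.sin (Real.pi / M) / 2 : ℝ) : ℂ)]
    rw [← mul_sum, ← one_add_mul_conj_sinePoly hM, korovkinKernel]
    have h := two_cos_sub_mul_sinePoly hM x
    rw [Complex.ofReal_mul, ← Complex.mul_conj, Complex.ofReal_sub, Complex.ofReal_div,
      Complex.ofReal_ofNat]
    linear_combination (1 / 2 : ℂ) * (starRingEnd ℂ) (sinePoly M x) * h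

lemma exists_abs_sub_intCast_lt_of_cos_lt {M : ℕ} {x : ℝ} (hM : 2 ≤ M)
    (h : Real.cos (2 * (Real.pi / M)) < Real.cos (2 * Real.pi * x)) :
    ∃ k : ℤ, |x - k| < 1 / M := by
  refine ⟨round x, ?_⟩
  by_contra! hge
  have hr := abs_sub_round x
  have hM' : (0 : ℝ) < M := by positivity
  have hpi := Real.pi_pos
  have hcos : Real.cos (2 * Real.pi * x) = Real.cos (2 * Real.pi * |x - round x|) := by
    have : 2 * Real.pi * |x - round x| = |2 * Real.pi * (x - round x)| := by
      rw [abs_mul, abs_of_pos Real.two_pi_pos]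
    rw [this, Real.cos_abs]
    have : 2 * Real.pi * (x - round x) = 2 * Real.pi * x - round x * (2 * Real.pi) := by ring
    rw [this, Real.cos_sub_int_mul_two_pi]
  rw [hcos] at h
  refine absurd h (not_lt.2 (Real.cos_le_cos_of_nonneg_of_le_pi (by positivity) (by nlinarith) ?_))
  calc 2 * (Real.pi / M) = 2 * Real.pi * (1 / M) := by ring
    _ ≤ _ := by gcongr

open Classical in
lemma card_le_of_expSumError_le {M n : ℕ} (hM : 2 ≤ M) (x y : ℕ → ℝ)
    (hE : expSumError x y n M ≤ n / 60) :
    (#{m ∈ range n | (∃ k : ℤ, |x m - k| ≤ 1 / (6 * M)) ∧ ∃ l : ℤ, |y m - l| ≤ 1 / (6 * M)} : ℝ) ≤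
      128 * n / (M : ℝ) ^ 2 := by
  have hM' : (0 : ℝ) < M := by positivity
  have hP := isTrigPoly_korovkinKernel hM
  have hsum := (abs_le.1 (hP.abs_sum_sub_le hP x y n)).2
  have hle : ∀ z : ℝ, (∃ k : ℤ, |z - k| ≤ 1 / (6 * M)) → (M : ℝ) ^ 2 / 16 ≤ korovkinKernel M z := by
    rintro z ⟨k, hk⟩
    rw [← korovkinKernel_sub_intCast M z k]
    exact le_korovkinKernel hM hk
  set s := {m ∈ range n | (∃ k : ℤ, |x m - k| ≤ 1 / (6 * M)) ∧ ∃ l : ℤ, |y m - l| ≤ 1 / (6 * M)}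
  have hcount : (#s : ℝ) * ((M : ℝ) ^ 2 / 16 * ((M : ℝ) ^ 2 / 16)) ≤
      ∑ m ∈ range n, korovkinKernel M (x m) * korovkinKernel M (y m) := by
    rw [← nsmul_eq_mul, ← sum_const]
    calc _ ≤ ∑ m ∈ s, korovkinKernel M (x m) * korovkinKernel M (y m) := by
          refine sum_le_sum fun m hm => ?_
          have := (mem_filter.1 hm).2
          exact mul_le_mul (hle _ this.1) (hle _ this.2) (by positivity)
            (korovkinKernel_nonneg _ _)
      _ ≤ _ := sum_le_sum_of_subset_of_nonneg (filter_subset _ _) fun m _ _ =>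
          mul_nonneg (korovkinKernel_nonneg _ _) (korovkinKernel_nonneg _ _)
  have hn : (0 : ℝ) ≤ n := n.cast_nonneg
  have h2 : (M : ℝ) * M * expSumError x y n M ≤ M * M * (n / 60) := by gcongr
  rw [le_div_iff₀ (by positivity)]
  have h3 : (#s : ℝ) * (M : ℝ) ^ 2 * ((M : ℝ) ^ 2 / 256) ≤ 128 * n * ((M : ℝ) ^ 2 / 256) := by
    nlinarith [mul_nonneg (sq_nonneg (M : ℝ)) hn]
  exact le_of_mul_le_mul_right h3 (by positivity)

open Classical in
lemma le_card_of_expSumError_le {M n : ℕ} (hM : 3 ≤ M) (x y : ℕ → ℝ)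
    (hE : expSumError x y n M ≤ n / 60) :
    n / (80 * (M : ℝ) ^ 2) ≤
      (#{m ∈ range n | (∃ k : ℤ, |x m - k| < 1 / M) ∧ ∃ l : ℤ, |y m - l| < 1 / M} : ℝ) := by
  have hM' : (3 : ℝ) ≤ M := by exact_mod_cast hM
  have hpi := Real.pi_pos
  have hpi4 := Real.pi_le_four
  have hpi2 : Real.pi ^ 2 ≤ 10 := by nlinarith [Real.pi_lt_d2]
  have hP := isTrigPoly_korovkinKernel (M := M) (by omega)
  have hW := isTrigPoly_korovkinKernel_mul_cos_sub (M := M) (by omega)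
  set η := Real.pi / M with hη
  have hη0 : 0 < η := by positivity
  have hηM : η * M = Real.pi := by rw [hη]; field_simp
  have hη3 : η ≤ Real.pi / 3 := by rw [hη]; gcongr
  have hPP := (abs_le.1 (hP.abs_sum_sub_le hP x y n)).1
  have hWP := (abs_le.1 (hW.abs_sum_sub_le hP x y n)).1
  have hPW := (abs_le.1 (hP.abs_sum_sub_le hW x y n)).1
  have hsinM : Real.sin η * M ≤ 4 := by
    have : Real.sin η ≤ η := Real.sin_le hη0.le
    calc _ ≤ η * M := by gcongr
      _ ≤ 4 := by linarith
  set P := korovkinKernel M with hPdef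
  set E := expSumError x y n M with hEdef
  have hE0 : 0 ≤ E := sum_nonneg fun _ _ => norm_nonneg _
  have hn : (0 : ℝ) ≤ n := n.cast_nonneg
  have hcos : 1 / 2 ≤ Real.cos η := by
    rw [← Real.cos_pi_div_three]
    exact Real.cos_le_cos_of_nonneg_of_le_pi hη0.le (by linarith) hη3
  have hcos' : 2 / (M : ℝ) ^ 2 ≤ 1 - Real.cos η := by
    have := Real.cos_le_one_sub_mul_cos_sq (x := η) (by rw [abs_of_pos hη0]; linarith)
    have e : 2 / Real.pi ^ 2 * η ^ 2 = 2 / (M : ℝ) ^ 2 := by rw [hη]; field_simp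
    linarith
  set D := 2 * Real.cos η - 1 - Real.cos (2 * η) with hD
  have hDM : 2 ≤ D * (M : ℝ) ^ 2 := by
    have : D = 2 * Real.cos η * (1 - Real.cos η) := by rw [hD, Real.cos_two_mul]; ring
    rw [← div_le_iff₀ (by positivity), this]
    have hpos : 0 ≤ 2 / (M : ℝ) ^ 2 := by positivity
    nlinarith [mul_nonneg (sub_nonneg.2 hcos) (hpos.trans hcos')]
  set R : ℕ → ℝ := fun m => P (x m) * P (y m) *
    (Real.cos (2 * Real.pi * x m) + Real.cos (2 * Real.pi * y m) - 1 - Real.cos (2 * η)) with hR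
  have hRsum : ∑ m ∈ range n, R m =
      ∑ m ∈ range n, P (x m) * (Real.cos (2 * Real.pi * x m) - Real.cos η) * P (y m) +
      ∑ m ∈ range n, P (x m) * (P (y m) * (Real.cos (2 * Real.pi * y m) - Real.cos η)) +
      D * ∑ m ∈ range n, P (x m) * P (y m) := by
    rw [mul_sum, ← sum_add_distrib, ← sum_add_distrib]
    refine sum_congr rfl fun m _ => ?_
    simp only [hR, hD]
    ring
  have hlow : (n : ℝ) / 4 ≤ ∑ m ∈ range n, R m := by
    have hD0 : 0 ≤ D := by nlinarith
    have h1 := mul_le_mul_of_nonneg_left hPP hD0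
    have h2 : 2 * ((n : ℝ) / 4 - E) ≤ D * (M : ℝ) ^ 2 * (n / 4 - E) := by
      gcongr
      linarith
    have h3 : Real.sin η * M * E ≤ 4 * E := by gcongr
    rw [hRsum]
    nlinarith
  set s := {m ∈ range n | (∃ k : ℤ, |x m - k| < 1 / M) ∧ ∃ l : ℤ, |y m - l| < 1 / M}
  have hup : ∑ m ∈ range n, R m ≤ #s * (20 * (M : ℝ) ^ 2) := by
    have hcos2 : 1 - Real.cos (2 * η) ≤ 20 / (M : ℝ) ^ 2 := by
      have := Real.one_sub_sq_div_two_le_cos (x := 2 * η)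
      have e : (2 * η) ^ 2 / 2 = 2 * Real.pi ^ 2 / (M : ℝ) ^ 2 := by rw [hη]; field_simp
      rw [e] at this
      have : 2 * Real.pi ^ 2 / (M : ℝ) ^ 2 ≤ 20 / (M : ℝ) ^ 2 := by gcongr; linarith
      linarith
    have hcase : ∀ m ∈ range n, R m ≤
        if (∃ k : ℤ, |x m - k| < 1 / M) ∧ ∃ l : ℤ, |y m - l| < 1 / M
          then 20 * (M : ℝ) ^ 2 else 0 := by
      intro m _
      have hPx := korovkinKernel_nonneg M (x m)
      have hPy := korovkinKernel_nonneg M (y m)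
      have hPx' := korovkinKernel_le M (x m)
      have hPy' := korovkinKernel_le M (y m)
      have hcx := Real.cos_le_one (2 * Real.pi * x m)
      have hcy := Real.cos_le_one (2 * Real.pi * y m)
      split_ifs with h
      · calc R m ≤ (M : ℝ) ^ 2 * (M : ℝ) ^ 2 * (20 / (M : ℝ) ^ 2) := by
              have h0 : 0 ≤ 20 / (M : ℝ) ^ 2 := by positivity
              have h1 : P (x m) * P (y m) ≤ (M : ℝ) ^ 2 * (M : ℝ) ^ 2 :=
                mul_le_mul hPx' hPy' hPy (by positivity)
              calc R m ≤ P (x m) * P (y m) * (20 / (M : ℝ) ^ 2) :=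
                    mul_le_mul_of_nonneg_left (by linarith) (mul_nonneg hPx hPy)
                _ ≤ _ := by gcongr
          _ = _ := by field_simp
      · refine mul_nonpos_of_nonneg_of_nonpos (mul_nonneg hPx hPy) ?_
        by_contra! hpos
        exact h ⟨exists_abs_sub_intCast_lt_of_cos_lt (by omega) (by rw [← hη]; linarith),
          exists_abs_sub_intCast_lt_of_cos_lt (by omega) (by rw [← hη]; linarith)⟩
    refine (sum_le_sum hcase).trans (le_of_eq ?_)
    rw [← sum_filter, sum_const, nsmul_eq_mul]
  rw [div_le_iff₀ (by positivity)]
  linarith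

lemma torusDist_le_of_abs_lt {x y : ℝ × ℝ} {k l : ℤ} {r δ : ℝ} (hr : 2 * r ≤ δ)
    (hk : |x.1 - y.1 - k| < r) (hl : |x.2 - y.2 - l| < r) : torusDist x y ≤ δ := by
  have hr0 : 0 < r := (abs_nonneg _).trans_lt hk
  refine (ciInf_le ⟨0, by rintro _ ⟨_, rfl⟩; exact Real.sqrt_nonneg _⟩ (-k, -l)).trans ?_
  refine Real.sqrt_le_iff.2 ⟨by linarith, ?_⟩
  have h1 := sq_lt_sq' (abs_lt.1 hk).1 (abs_lt.1 hk).2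
  have h2 := sq_lt_sq' (abs_lt.1 hl).1 (abs_lt.1 hl).2
  push_cast
  rw [← sub_eq_add_neg, ← sub_eq_add_neg]
  nlinarith

lemma exists_abs_le_of_torusDist_lt {x y : ℝ × ℝ} {r : ℝ} (h : torusDist x y < r) :
    (∃ k : ℤ, |x.1 - y.1 - k| ≤ r) ∧ ∃ l : ℤ, |x.2 - y.2 - l| ≤ r := by
  obtain ⟨v, hv⟩ := exists_lt_of_ciInf_lt h
  refine ⟨⟨-v.1, ?_⟩, ⟨-v.2, ?_⟩⟩
  · refine (Real.abs_le_sqrt ?_).trans hv.le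
    push_cast
    nlinarith [sq_nonneg (x.2 - y.2 + (v.2 : ℝ))]
  · refine (Real.abs_le_sqrt ?_).trans hv.le
    push_cast
    nlinarith [sq_nonneg (x.1 - y.1 + (v.1 : ℝ))]

lemma exists_nat_forall_mul_rpow_le (C : ℝ) {τ ε : ℝ} (hτ : 0 < τ) (hε : 0 < ε) :
    ∃ n₁ : ℕ, ∀ n : ℕ, n₁ ≤ n → C * (n : ℝ) ^ (1 - τ) ≤ ε * n := by
  have h := ((tendsto_rpow_neg_atTop hτ).comp tendsto_natCast_atTop_atTop).const_mul C
  rw [mul_zero] at h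
  obtain ⟨n₁, hn₁⟩ := Filter.eventually_atTop.1 (h.eventually_le_const hε)
  refine ⟨max n₁ 1, fun n hn => ?_⟩
  have hn0 : (0 : ℝ) < n := by exact_mod_cast (le_max_right _ _).trans hn
  have := hn₁ n ((le_max_left _ _).trans hn)
  rw [sub_eq_add_neg, add_comm, Real.rpow_add hn0, Real.rpow_one, ← mul_assoc]
  exact mul_le_mul_of_nonneg_right this hn0.le

lemma card_filter_Icc_one_eq (n : ℕ) (p : ℕ → Prop) [DecidablePred p] :
    #{m ∈ Icc 1 n | p m} = #{m ∈ range n | p (m + 1)} := by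
  refine (card_bij (fun m _ => m + 1) ?_ ?_ ?_).symm
  · intro m hm
    simp only [mem_filter, mem_range, mem_Icc] at hm ⊢
    exact ⟨by omega, hm.2⟩
  · intro a _ b _ h
    exact Nat.succ_injective h
  · intro m hm
    simp only [mem_filter, mem_Icc] at hm
    refine ⟨m - 1, ?_, by omega⟩
    simp only [mem_filter, mem_range]
    refine ⟨by omega, ?_⟩
    rw [Nat.sub_add_cancel hm.1.1]
    exact hm.2

open Classical in
/-- Two-sided counting bounds for a ball of radius `δ`, given cancellation in all exponential sums
of frequency at most `6 / δ`. -/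
lemma card_torusDist_le_bounds {n : ℕ} {δ : ℝ} (hδ0 : 0 < δ) (hδ : δ < 1) (x y : ℕ → ℝ)
    (hE : ∀ L : ℕ, 1 ≤ L → (L : ℝ) ≤ 3 / δ → expSumError x y n L ≤ n / 60) (v : ℝ × ℝ) :
    n * δ ^ 2 / 720 ≤ (#{m ∈ range n | torusDist (x m, y m) v ≤ δ} : ℝ) ∧
      (#{m ∈ range n | torusDist (x m, y m) v ≤ δ} : ℝ) ≤ 73728 * n * δ ^ 2 := by
  have hn : (0 : ℝ) ≤ n := n.cast_nonneg
  have hE' : ∀ L : ℕ, 1 ≤ L → (L : ℝ) ≤ 3 / δ →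
      expSumError (fun m => x m - v.1) (fun m => y m - v.2) n L ≤ n / 60 := by
    intro L h1 h2
    rw [expSumError_sub_const]
    exact hE L h1 h2
  constructor
  · set M := ⌈2 / δ⌉₊ with hM
    have hMge : 2 / δ ≤ M := Nat.le_ceil _
    have hMlt : (M : ℝ) < 2 / δ + 1 := Nat.ceil_lt_add_one (by positivity)
    have hδ1 : 1 < 1 / δ := (one_lt_div hδ0).2 hδ
    have e2 : 2 / δ = 2 * (1 / δ) := by ring
    have e3 : 3 / δ = 3 * (1 / δ) := by ring
    have hMle : (M : ℝ) ≤ 3 / δ := by linarith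
    have hM3 : 3 ≤ M := by
      have : (2 : ℝ) < M := by linarith
      exact_mod_cast this
    have hM0 : (0 : ℝ) < M := by positivity
    calc n * δ ^ 2 / 720 = n / (80 * (3 / δ) ^ 2) := by field_simp; ring
      _ ≤ n / (80 * (M : ℝ) ^ 2) := by gcongr
      _ ≤ _ := le_card_of_expSumError_le hM3 _ _ (hE' M (by omega) hMle)
      _ ≤ _ := by
          refine Nat.cast_le.2 (card_le_card fun m hm => ?_)
          simp only [mem_filter] at hm ⊢
          obtain ⟨hm0, ⟨k, hk⟩, l, hl⟩ := hm
          refine ⟨hm0, torusDist_le_of_abs_lt (r := 1 / M) ?_ hk hl⟩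
          rw [mul_one_div, div_le_comm₀ hM0 hδ0]
          exact hMge
  · rcases lt_or_ge (1 / 24) δ with hlarge | hsmall
    · calc (#{m ∈ range n | torusDist (x m, y m) v ≤ δ} : ℝ) ≤ n := by
            have := card_filter_le (range n) fun m => torusDist (x m, y m) v ≤ δ
            rw [card_range] at this
            exact_mod_cast this
        _ ≤ 73728 * n * δ ^ 2 := by nlinarith [mul_nonneg hn hδ0.le]
    · set M := ⌊1 / (12 * δ)⌋₊ with hM
      have e1 : 1 / (12 * δ) = 2 * (1 / (24 * δ)) := by field_simp; norm_num
      have h24 : 1 ≤ 1 / (24 * δ) := (one_le_div (by positivity)).2 (by linarith)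
      have hMle : (M : ℝ) ≤ 1 / (12 * δ) := Nat.floor_le (by positivity)
      have hMgt : 1 / (12 * δ) < M + 1 := Nat.lt_floor_add_one _
      have hMge : 1 / (24 * δ) ≤ M := by linarith
      have hM2 : 2 ≤ M := Nat.le_floor (by push_cast; linarith)
      have hM0 : (0 : ℝ) < M := by positivity
      have hM3 : (M : ℝ) ≤ 3 / δ := by
        refine hMle.trans ?_
        gcongr
        · norm_num
        · linarith
      have hrad : 2 * δ ≤ 1 / (6 * M) := by
        rw [le_div_comm₀ (by positivity) (by positivity)]
        calc (6 : ℝ) * M ≤ 6 * (1 / (12 * δ)) := by gcongr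
          _ = 1 / (2 * δ) := by field_simp; norm_num
      calc (#{m ∈ range n | torusDist (x m, y m) v ≤ δ} : ℝ)
          ≤ #{m ∈ range n | (∃ k : ℤ, |x m - v.1 - k| ≤ 1 / (6 * M)) ∧
              ∃ l : ℤ, |y m - v.2 - l| ≤ 1 / (6 * M)} := by
            refine Nat.cast_le.2 (card_le_card fun m hm => ?_)
            simp only [mem_filter] at hm ⊢
            exact ⟨hm.1, exists_abs_le_of_torusDist_lt (hm.2.trans_lt (by linarith))⟩
        _ ≤ 128 * n / (M : ℝ) ^ 2 :=
            card_le_of_expSumError_le hM2 (fun m => x m - v.1) (fun m => y m - v.2)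
              (hE' M (by omega) hM3)
        _ ≤ 128 * n / (1 / (24 * δ)) ^ 2 := by gcongr
        _ = 73728 * n * δ ^ 2 := by field_simp; ring

open Classical in
theorem effective_torus_density (α β γ : ℝ) (κ : ℝ) (hκ : 1 ≤ κ)
    (hdio : ∃ c > 0, ∀ q : ℕ, 0 < q → ∀ p : ℤ, c / (q : ℝ) ^ κ ≤ |(q : ℝ) * α - (p : ℝ)|)
    (ν : ℝ) (hν0 : 0 < ν) (hν : ν < 1 / (4 * κ)) :
    ∃ c₁ c₂ T₀ : ℝ, 0 < c₁ ∧ c₁ ≤ c₂ ∧ 1 ≤ T₀ ∧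
      ∀ T : ℝ, T₀ ≤ T → ∀ δ : ℝ, T ^ (-ν) ≤ δ → δ < 1 → ∀ v₀ : ℝ × ℝ,
        c₁ * T * δ ^ 2 ≤
          (((Finset.Icc 1 ⌊T⌋₊).filter fun m : ℕ =>
              torusDist (2 * α * m + β, α * m ^ 2 + β * m + γ) v₀ ≤ δ).card : ℝ) ∧
        (((Finset.Icc 1 ⌊T⌋₊).filter fun m : ℕ =>
              torusDist (2 * α * m + β, α * m ^ 2 + β * m + γ) v₀ ≤ δ).card : ℝ)
          ≤ c₂ * T * δ ^ 2 := by
  obtain ⟨c, hc, hdio⟩ := hdio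
  obtain ⟨C, τ, -, hτ, n₀, hn₀⟩ :=
    exists_expSumError_le_rpow β γ hκ hc hdio hν0 hν 6 (by norm_num)
  obtain ⟨n₁, hn₁⟩ := exists_nat_forall_mul_rpow_le C hτ (show (0 : ℝ) < 1 / 60 by norm_num)
  refine ⟨1 / 1440, 73728, n₀ + n₁ + 1, by norm_num, by norm_num, ?_, ?_⟩
  · exact le_add_of_nonneg_left (by positivity)
  intro T hT δ hδT hδ v₀
  have hn₀0 : (0 : ℝ) ≤ n₀ := n₀.cast_nonneg
  have hn₁0 : (0 : ℝ) ≤ n₁ := n₁.cast_nonneg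
  have hT1 : 1 ≤ T := by linarith
  have hT0 : 0 < T := by linarith
  have hδ0 : 0 < δ := (Real.rpow_pos_of_pos hT0 _).trans_le hδT
  set n := ⌊T⌋₊ with hn
  have hnT : (n : ℝ) ≤ T := Nat.floor_le hT0.le
  have hTn : T < n + 1 := Nat.lt_floor_add_one T
  have hn1 : (1 : ℝ) ≤ n := by exact_mod_cast Nat.le_floor (by simpa using hT1)
  have hn_n₀ : n₀ ≤ n := Nat.le_floor (by linarith)
  have hn_n₁ : n₁ ≤ n := Nat.le_floor (by linarith)
  have hν1 : ν ≤ 1 := by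
    refine hν.le.trans ?_
    rw [div_le_one (by positivity)]
    linarith
  have hinv : 1 / δ ≤ 2 * (n : ℝ) ^ ν := by
    calc 1 / δ ≤ 1 / T ^ (-ν) := by gcongr
      _ = T ^ ν := by rw [Real.rpow_neg hT0.le, one_div, inv_inv]
      _ ≤ (2 * n : ℝ) ^ ν := by gcongr; linarith
      _ = 2 ^ ν * (n : ℝ) ^ ν := Real.mul_rpow (by norm_num) (by positivity)
      _ ≤ 2 ^ (1 : ℝ) * (n : ℝ) ^ ν := by gcongr; norm_num
      _ = _ := by rw [Real.rpow_one]
  have key := card_torusDist_le_bounds (n := n) hδ0 hδ (fun m => 2 * α * (m + 1 : ℕ) + β)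
    (fun m => α * ((m + 1 : ℕ) : ℝ) ^ 2 + β * (m + 1 : ℕ) + γ) (fun L hL hLδ => by
      refine (hn₀ n hn_n₀ L hL ?_).trans ((hn₁ n hn_n₁).trans_eq (by ring))
      calc (L : ℝ) ≤ 3 * (1 / δ) := by rwa [mul_one_div]
        _ ≤ 3 * (2 * (n : ℝ) ^ ν) := by gcongr
        _ = 6 * (n : ℝ) ^ ν := by ring) v₀
  rw [card_filter_Icc_one_eq]
  have hδ2 : 0 ≤ δ ^ 2 := sq_nonneg δ
  constructor
  · refine le_trans ?_ key.1
    nlinarith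
  · refine key.2.trans ?_
    gcongr
end

section
/- Let Q(α,β,γ) = β² − 4αγ, let ξ = (α, β, γ) ∈ ℝ³ with α being κ-Diophantine for some κ ≥ 1, and let Q_ξ(v) = Q(v + ξ). Then for any ν < 1/(8κ) and any t ∈ ℝ, there exist c > 0 and T₀ ≥ 1 (depending on ξ, ν, t) such that for all T ≥ T₀ and all δ with T^{−ν} ≤ δ < 1: #{v ∈ ℤ³ : ‖v‖ ≤ T and |Q_ξ(v) − t| ≤ δ} ≥ c T^{1/2} δ². -/
/-- the discriminant quadratic form on row vectors -/
def Qform (v : Fin 3 → ℝ) : ℝ := v 1 ^ 2 - 4 * v 0 * v 2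

/-- Euclidean norm on row vectors in ℝ³ -/
noncomputable def enorm3 (v : Fin 3 → ℝ) : ℝ := Real.sqrt (∑ i, v i ^ 2)

open Finset

/-- `unitExp x = exp (2πix)`. -/
noncomputable def unitExp (x : ℝ) : ℂ := Complex.exp (Complex.I * ((2 * Real.pi * x : ℝ) : ℂ))

theorem unitExp_add (x y : ℝ) : unitExp (x + y) = unitExp x * unitExp y := by
  rw [unitExp, unitExp, unitExp, ← Complex.exp_add]
  congr 1
  push_cast
  ring

theorem unitExp_zero : unitExp 0 = 1 := by simp [unitExp]

theorem norm_unitExp (x : ℝ) : ‖unitExp x‖ = 1 := by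
  rw [unitExp, Complex.norm_exp_I_mul_ofReal]

theorem conj_unitExp (x : ℝ) : (starRingEnd ℂ) (unitExp x) = unitExp (-x) := by
  rw [unitExp, unitExp, ← Complex.exp_conj, map_mul, Complex.conj_I, Complex.conj_ofReal]
  congr 1
  push_cast
  ring

theorem unitExp_nat_mul (n : ℕ) (x : ℝ) : unitExp (n * x) = unitExp x ^ n := by
  rw [unitExp, unitExp, ← Complex.exp_nat_mul]
  congr 1
  push_cast
  ring

theorem unitExp_sub_int (x : ℝ) (n : ℤ) : unitExp (x - n) = unitExp x := by
  rw [unitExp, unitExp, Complex.exp_eq_exp_iff_exists_int]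
  refine ⟨-n, ?_⟩
  push_cast
  ring

theorem four_mul_abs_le_norm_unitExp_sub_one {y : ℝ} (hy : |y| ≤ 1 / 2) :
    4 * |y| ≤ ‖unitExp y - 1‖ := by
  rw [unitExp, Complex.norm_exp_I_mul_ofReal_sub_one, norm_mul, Real.norm_eq_abs, Real.norm_eq_abs,
    show 2 * Real.pi * y / 2 = Real.pi * y by ring]
  have hpi := Real.pi_pos
  have h := Real.mul_le_sin (x := Real.pi * |y|) (by positivity) (by nlinarith)
  have h2 : 2 / Real.pi * (Real.pi * |y|) = 2 * |y| := by field_simp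
  have h3 : Real.sin (Real.pi * |y|) ≤ |Real.sin (Real.pi * y)| := by
    rcases abs_cases y with ⟨h, -⟩ | ⟨h, -⟩ <;> rw [h]
    · exact le_abs_self _
    · rw [mul_neg, Real.sin_neg]; exact neg_le_abs _
  rw [abs_of_pos (two_pos : (0 : ℝ) < 2)]
  linarith

theorem norm_sum_unitExp_mul_abs_sub_round_le (n : ℕ) (x : ℝ) :
    ‖∑ b ∈ range n, unitExp (b * x)‖ * (2 * |x - round x|) ≤ 1 := by
  set y := x - round x
  have hy : |y| ≤ 1 / 2 := abs_sub_round x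
  have hxy : unitExp y = unitExp x := unitExp_sub_int x _
  have hgeom : (∑ b ∈ range n, unitExp (b * x)) * (unitExp y - 1) = unitExp (n * x) - 1 := by
    simp_rw [unitExp_nat_mul, hxy]
    exact geom_sum_mul _ _
  have h1 : ‖unitExp (n * x) - 1‖ ≤ 2 := by
    refine (norm_sub_le _ _).trans ?_
    rw [norm_unitExp, norm_one]; norm_num
  rw [← hgeom, norm_mul] at h1
  have := mul_le_mul_of_nonneg_left (four_mul_abs_le_norm_unitExp_sub_one hy)
    (norm_nonneg (∑ b ∈ range n, unitExp (b * x)))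
  linarith

theorem norm_sum_unitExp_le (n : ℕ) (x : ℝ) : ‖∑ b ∈ range n, unitExp (b * x)‖ ≤ n := by
  refine (norm_sum_le _ _).trans ?_
  simp [norm_unitExp]

/-- The nearest-integer residue of `x`, measured in steps of length `1 / N`. -/
noncomputable def residueIndex (N : ℕ) (x : ℝ) : ℤ := ⌊(N : ℝ) * (x - round x)⌋

theorem norm_sum_unitExp_le_div {n N : ℕ} (hn : n ≤ N) (x : ℝ) :
    ‖∑ b ∈ range n, unitExp (b * x)‖ ≤ 3 * N * (1 / (|(residueIndex N x : ℝ)| + 1)) := by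
  have h1 := norm_sum_unitExp_mul_abs_sub_round_le n x
  have h2 := (norm_sum_unitExp_le n x).trans (Nat.cast_le.mpr hn)
  set W := ‖∑ b ∈ range n, unitExp (b * x)‖
  have hW : 0 ≤ W := norm_nonneg _
  have h3 : |(residueIndex N x : ℝ)| ≤ N * |x - round x| + 1 := by
    have a1 := Int.floor_le ((N : ℝ) * (x - round x))
    have a2 := Int.lt_floor_add_one ((N : ℝ) * (x - round x))
    have a3 : |(N : ℝ) * (x - round x)| = N * |x - round x| := by
      rw [abs_mul, Nat.abs_cast]
    rw [← a3, residueIndex]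
    have a4 := neg_abs_le ((N : ℝ) * (x - round x))
    have a5 := le_abs_self ((N : ℝ) * (x - round x))
    rw [abs_le]
    constructor <;> linarith
  rw [mul_one_div, le_div_iff₀ (by positivity)]
  have hN : (0 : ℝ) ≤ N := Nat.cast_nonneg _
  nlinarith [mul_le_mul_of_nonneg_left h3 hW, mul_le_mul_of_nonneg_left h1 hN]

theorem sum_Icc_one_div_abs_add_one_le (N : ℕ) :
    ∑ j ∈ Icc (-(N : ℤ)) N, 1 / (|(j : ℝ)| + 1) ≤ 2 * (1 + Real.log (N + 1)) := by
  have hsub : Icc (-(N : ℤ)) N ⊆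
      (range (N + 1)).image (fun k : ℕ => (k : ℤ)) ∪
        (range (N + 1)).image (fun k : ℕ => -(k : ℤ)) := by
    intro j hj
    rw [mem_Icc] at hj
    simp only [mem_union, mem_image, mem_range]
    rcases le_total 0 j with h | h
    · exact Or.inl ⟨j.toNat, by omega, by omega⟩
    · exact Or.inr ⟨(-j).toNat, by omega, by omega⟩
  have hharm : ∑ k ∈ range (N + 1), 1 / ((k : ℝ) + 1) ≤ 1 + Real.log (N + 1) := by
    have := harmonic_le_one_add_log (N + 1)
    rw [harmonic] at this
    push_cast at this
    simpa using this
  have hnn : ∀ j : ℤ, 0 ≤ 1 / (|(j : ℝ)| + 1) := fun j => by positivity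
  refine (sum_le_sum_of_subset_of_nonneg hsub fun j _ _ => hnn j).trans ?_
  have hui := sum_union_inter (s₁ := (range (N + 1)).image (fun k : ℕ => (k : ℤ)))
    (s₂ := (range (N + 1)).image (fun k : ℕ => -(k : ℤ))) (f := fun j : ℤ => 1 / (|(j : ℝ)| + 1))
  have hinter := sum_nonneg (s := (range (N + 1)).image (fun k : ℕ => (k : ℤ)) ∩
    (range (N + 1)).image (fun k : ℕ => -(k : ℤ))) fun j _ => hnn j
  rw [sum_image (by intro a _ b _ h; simpa using h),
    sum_image (by intro a _ b _ h; simpa using h)] at hui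
  simp only [Int.cast_natCast, Int.cast_neg, abs_neg, Nat.abs_cast] at hui
  linarith

theorem sum_block_le {N q : ℕ} (φ : ℝ) (hN : 0 < N)
    (hsep : ∀ k : ℕ, 0 < k → k < q → ∀ p : ℤ, 1 / (N : ℝ) ≤ |k * φ - p|) (h₀ : ℕ) :
    ∑ i ∈ range q, 1 / (|(residueIndex N (((h₀ + i : ℕ) : ℝ) * φ) : ℝ)| + 1) ≤
      2 * (1 + Real.log (N + 1)) := by
  have hNR : (0 : ℝ) < N := Nat.cast_pos.mpr hN
  set f : ℕ → ℤ := fun i => residueIndex N (((h₀ + i : ℕ) : ℝ) * φ) with hf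
  have key : ∀ i j : ℕ, i < j → j < q → f i ≠ f j := by
    intro i j hij hj heq
    have h1 := hsep (j - i) (by omega) (by omega)
      (round (((h₀ + j : ℕ) : ℝ) * φ) - round (((h₀ + i : ℕ) : ℝ) * φ))
    have h2 := Int.abs_sub_lt_one_of_floor_eq_floor heq
    rw [← mul_sub, abs_mul, Nat.abs_cast, abs_sub_comm] at h2
    rw [div_le_iff₀ hNR] at h1
    have h3 : ((j - i : ℕ) : ℝ) * φ - ((round (((h₀ + j : ℕ) : ℝ) * φ) -
        round (((h₀ + i : ℕ) : ℝ) * φ) : ℤ) : ℝ) =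
        ((h₀ + j : ℕ) : ℝ) * φ - round (((h₀ + j : ℕ) : ℝ) * φ) -
          (((h₀ + i : ℕ) : ℝ) * φ - round (((h₀ + i : ℕ) : ℝ) * φ)) := by
      rw [Nat.cast_sub hij.le]
      push_cast
      ring
    rw [h3] at h1
    linarith
  have hinj : Set.InjOn f (range q) := by
    intro i hi j hj h
    simp only [coe_range, Set.mem_Iio] at hi hj
    rcases lt_trichotomy i j with hij | hij | hij
    · exact absurd h (key i j hij hj)
    · exact hij
    · exact absurd h.symm (key j i hij hi)
  have himg : (range q).image f ⊆ Icc (-(N : ℤ)) N := by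
    intro z hz
    obtain ⟨i, -, rfl⟩ := mem_image.mp hz
    have hr := abs_le.mp (abs_sub_round (((h₀ + i : ℕ) : ℝ) * φ))
    simp only [hf, residueIndex, mem_Icc]
    constructor
    · rw [Int.le_floor]
      push_cast at hr ⊢
      nlinarith [hr.1]
    · rw [← Int.cast_le (R := ℝ)]
      refine (Int.floor_le _).trans ?_
      push_cast at hr ⊢
      nlinarith [hr.2]
  rw [← sum_image (f := fun j : ℤ => 1 / (|(j : ℝ)| + 1)) hinj]
  exact (sum_le_sum_of_subset_of_nonneg himg fun j _ _ => by positivity).trans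
    (sum_Icc_one_div_abs_add_one_le N)

theorem sum_range_mul_le {f : ℕ → ℝ} {q : ℕ} {B : ℝ}
    (hB : ∀ h₀, ∑ i ∈ range q, f (h₀ + i) ≤ B) (k : ℕ) :
    ∑ h ∈ range (k * q), f h ≤ k * B := by
  induction k with
  | zero => simp
  | succ k ih =>
    rw [add_mul, one_mul, sum_range_add]
    push_cast
    linarith [hB (k * q)]

/-- The van der Corput / Weyl differencing inequality. -/
theorem norm_sum_sq_le_correlations (z : ℕ → ℂ) (N : ℕ) :
    ‖∑ b ∈ range N, z b‖ ^ 2 ≤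
      2 * ∑ h ∈ range N, ‖∑ b ∈ range (N - h), z (b + h) * (starRingEnd ℂ) (z b)‖ := by
  have h1 : ∀ N : ℕ, ‖∑ b ∈ range N, z b‖ ^ 2 ≤
      2 * (∑ n ∈ range N, ∑ b ∈ range (n + 1), z n * (starRingEnd ℂ) (z b)).re := by
    intro N
    induction N with
    | zero => simp
    | succ N ih =>
      rw [sum_range_succ, sum_range_succ _ N, ← mul_sum, ← map_sum, sum_range_succ, map_add,
        mul_add, Complex.add_re, Complex.add_re, Complex.mul_conj, Complex.ofReal_re,
        Complex.sq_norm, Complex.normSq_add, ← Complex.sq_norm (∑ b ∈ range N, z b)]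
      have h2 : (∑ b ∈ range N, z b) * (starRingEnd ℂ) (z N) =
          (starRingEnd ℂ) (z N * (starRingEnd ℂ) (∑ b ∈ range N, z b)) := by
        rw [map_mul, Complex.conj_conj, mul_comm]
      rw [h2, Complex.conj_re]
      linarith [Complex.normSq_nonneg (z N)]
  refine (h1 N).trans ?_
  have h3 : ∑ n ∈ range N, ∑ b ∈ range (n + 1), z n * (starRingEnd ℂ) (z b) =
      ∑ h ∈ range N, ∑ b ∈ range (N - h), z (b + h) * (starRingEnd ℂ) (z b) := by
    rw [← sum_range_diag_flip N fun h b => z (b + h) * (starRingEnd ℂ) (z b)]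
    refine sum_congr rfl fun n _ => ?_
    rw [← sum_range_reflect]
    refine sum_congr rfl fun b hb => ?_
    have : b ≤ n := by simpa [Nat.lt_succ_iff] using hb
    rw [show n + 1 - 1 - b = n - b by omega, Nat.sub_add_cancel this]
  rw [h3]
  have h4 := (Complex.re_le_norm _).trans
    (norm_sum_le (range N) fun h => ∑ b ∈ range (N - h), z (b + h) * (starRingEnd ℂ) (z b))
  linarith

theorem norm_quadratic_sum_sq_le {N q : ℕ} (A B C : ℝ) (hN : 0 < N) (hq : 0 < q)
    (hsep : ∀ k : ℕ, 0 < k → k < q → ∀ p : ℤ, 1 / (N : ℝ) ≤ |k * (2 * A) - p|) :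
    ‖∑ b ∈ range N, unitExp (A * b ^ 2 + B * b + C)‖ ^ 2 ≤
      12 * N * (N / q + 1) * (1 + Real.log (N + 1)) := by
  have hlog : 0 ≤ Real.log (N + 1) := Real.log_nonneg (by simp)
  set f : ℕ → ℝ := fun h => 1 / (|(residueIndex N ((h : ℝ) * (2 * A)) : ℝ)| + 1) with hf
  have h1 : ∀ h ∈ range N, ‖∑ b ∈ range (N - h),
      unitExp (A * (b + h : ℕ) ^ 2 + B * (b + h : ℕ) + C) *
      (starRingEnd ℂ) (unitExp (A * b ^ 2 + B * b + C))‖ ≤ 3 * N * f h := by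
    intro h _
    have : ∀ b : ℕ, unitExp (A * (b + h : ℕ) ^ 2 + B * (b + h : ℕ) + C) *
        (starRingEnd ℂ) (unitExp (A * b ^ 2 + B * b + C)) =
        unitExp (A * h ^ 2 + B * h) * unitExp (b * (h * (2 * A))) := by
      intro b
      rw [conj_unitExp, ← unitExp_add, ← unitExp_add]
      congr 1
      push_cast
      ring
    simp_rw [this]
    rw [← mul_sum, norm_mul, norm_unitExp, one_mul]
    exact norm_sum_unitExp_le_div (Nat.sub_le N h) _
  refine (norm_sum_sq_le_correlations _ N).trans ?_
  have h2 : ∑ h ∈ range N, f h ≤ (N / q + 1 : ℕ) * (2 * (1 + Real.log (N + 1))) := by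
    refine le_trans ?_ (sum_range_mul_le (f := f) (sum_block_le (2 * A) hN hsep) (N / q + 1))
    refine sum_le_sum_of_subset_of_nonneg (range_subset_range.mpr ?_) fun j _ _ => by positivity
    rw [add_mul, one_mul]
    exact (Nat.lt_div_mul_add hq).le
  have h3 : ((N / q + 1 : ℕ) : ℝ) ≤ N / q + 1 := by
    push_cast
    gcongr
    exact Nat.cast_div_le
  have h4 := sum_le_sum h1
  rw [← mul_sum] at h4
  have h5 := h2.trans (mul_le_mul_of_nonneg_right h3 (by positivity))
  have h6 := mul_le_mul_of_nonneg_left h5 (show (0 : ℝ) ≤ 3 * N by positivity)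
  linarith

open scoped Combinatorics.Additive Pointwise in
theorem pow_three_le_two_mul_addEnergy_range (L : ℕ) : L ^ 3 ≤ 2 * E[range L, range L] := by
  rcases Nat.eq_zero_or_pos L with rfl | hL
  · simp
  have h1 := le_card_add_mul_addEnergy (range L) (range L)
  have h2 : #(range L + range L) ≤ 2 * L := by
    rw [← card_range (2 * L)]
    refine card_le_card fun x hx => ?_
    obtain ⟨i, hi, j, hj, rfl⟩ := mem_add.mp hx
    rw [mem_range] at *
    omega
  rw [card_range] at h1
  have h3 := h1.trans (Nat.mul_le_mul_right _ h2)
  refine le_of_mul_le_mul_left ?_ hL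
  calc L * L ^ 3 = L ^ 2 * L ^ 2 := by ring
    _ ≤ 2 * L * E[range L, range L] := h3
    _ = _ := by ring

theorem norm_sum_unitExp_pow_four (L : ℕ) (x : ℝ) :
    ((‖∑ j ∈ range L, unitExp (j * x)‖ ^ 4 : ℝ) : ℂ) =
      ∑ w ∈ (range L ×ˢ range L) ×ˢ (range L ×ˢ range L),
        unitExp (((w.1.1 + w.2.1 - (w.1.2 + w.2.2) : ℤ) : ℝ) * x) := by
  have h1 : ((‖∑ j ∈ range L, unitExp (j * x)‖ ^ 2 : ℝ) : ℂ) =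
      ∑ u ∈ range L ×ˢ range L, unitExp (u.1 * x) * unitExp (-(u.2 * x)) := by
    push_cast
    rw [← Complex.mul_conj', map_sum, sum_mul_sum, ← sum_product']
    simp_rw [conj_unitExp]
  rw [show 4 = 2 + 2 from rfl, pow_add, Complex.ofReal_mul, h1, sum_mul_sum, ← sum_product']
  refine sum_congr rfl fun w _ => ?_
  rw [← unitExp_add, ← unitExp_add, ← unitExp_add]
  congr 1
  push_cast
  ring

theorem le_sum_norm_pow_four {N L : ℕ} {R : ℝ} (x : ℕ → ℝ)
    (hR : ∀ m : ℤ, m ≠ 0 → |m| < 2 * L → ‖∑ b ∈ range N, unitExp (m * x b)‖ ≤ R) (hR0 : 0 ≤ R) :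
    N * L ^ 3 / 2 - L ^ 4 * R ≤ ∑ b ∈ range N, ‖∑ j ∈ range L, unitExp (j * x b)‖ ^ 4 := by
  set P := (range L ×ˢ range L) ×ˢ (range L ×ˢ range L) with hP
  have h1 : ∑ b ∈ range N, ‖∑ j ∈ range L, unitExp (j * x b)‖ ^ 4 =
      ∑ w ∈ P, (∑ b ∈ range N,
        unitExp (((w.1.1 + w.2.1 - (w.1.2 + w.2.2) : ℤ) : ℝ) * x b)).re := by
    rw [← Complex.re_sum, sum_comm, ← Complex.ofReal_re (∑ b ∈ range N, _), Complex.ofReal_sum]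
    simp_rw [norm_sum_unitExp_pow_four]
    rfl
  have h2 : ∀ w ∈ P, (if w.1.1 + w.2.1 = w.1.2 + w.2.2 then (N : ℝ) else 0) - R ≤
      (∑ b ∈ range N, unitExp (((w.1.1 + w.2.1 - (w.1.2 + w.2.2) : ℤ) : ℝ) * x b)).re := by
    intro w hw
    simp only [hP, mem_product, mem_range] at hw
    split_ifs with h
    · rw [show (w.1.1 + w.2.1 - (w.1.2 + w.2.2) : ℤ) = 0 by omega]
      simp [unitExp_zero, hR0]
    · have := hR (w.1.1 + w.2.1 - (w.1.2 + w.2.2) : ℤ) (by omega)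
        (by rw [abs_lt]; constructor <;> omega)
      have h3 := (abs_le.mp ((Complex.abs_re_le_norm _).trans this)).1
      linarith
  have h3 := sum_le_sum h2
  rw [← h1, sum_sub_distrib, ← sum_filter, sum_const, sum_const, nsmul_eq_mul, nsmul_eq_mul] at h3
  have h4 : ((L ^ 3 : ℕ) : ℝ) ≤ ((2 * addEnergy (range L) (range L) : ℕ) : ℝ) :=
    Nat.cast_le.mpr (pow_three_le_two_mul_addEnergy_range L)
  rw [addEnergy, ← hP] at h4
  have h5 : (#P : ℝ) = L ^ 4 := by
    simp only [hP, card_product, card_range]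
    push_cast
    ring
  rw [h5] at h3
  push_cast at h4
  have h6 := mul_le_mul_of_nonneg_right h4 (Nat.cast_nonneg (α := ℝ) N)
  linarith

/-- A sequence with small exponential sums has many terms close to integers. -/
theorem le_card_near_int {N L : ℕ} {ρ : ℝ} (x : ℕ → ℝ) (hL : 0 < L) (hρ : 0 < ρ)
    (hLρ : 1 ≤ (L : ℝ) ^ 3 * ρ ^ 4)
    (hR : ∀ m : ℤ, m ≠ 0 → |m| < 2 * L →
      ‖∑ b ∈ range N, unitExp (m * x b)‖ ≤ N / (8 * L)) :
    (N : ℝ) ≤ 4 * L * #{b ∈ range N | |x b - round (x b)| ≤ ρ} := by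
  have hLR : (0 : ℝ) < L := Nat.cast_pos.mpr hL
  have hN : (0 : ℝ) ≤ N := Nat.cast_nonneg N
  have h1 := le_sum_norm_pow_four x hR (by positivity)
  set F : ℕ → ℝ := fun b => ‖∑ j ∈ range L, unitExp (j * x b)‖ with hF
  rw [← sum_filter_add_sum_filter_not (range N) (fun b => |x b - round (x b)| ≤ ρ)] at h1
  have hnear : ∑ b ∈ range N with |x b - round (x b)| ≤ ρ, F b ^ 4 ≤
      #{b ∈ range N | |x b - round (x b)| ≤ ρ} * (L : ℝ) ^ 4 := by
    rw [← nsmul_eq_mul]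
    refine sum_le_card_nsmul _ _ _ fun b _ => ?_
    exact pow_le_pow_left₀ (norm_nonneg _) (norm_sum_unitExp_le L (x b)) 4
  have hfar : ∑ b ∈ range N with ¬ |x b - round (x b)| ≤ ρ, F b ^ 4 ≤ N * (L ^ 3 / 16) := by
    have hb : ∀ b ∈ {b ∈ range N | ¬ |x b - round (x b)| ≤ ρ}, F b ^ 4 ≤ (L : ℝ) ^ 3 / 16 := by
      intro b hb
      have hb' := not_le.mp (mem_filter.mp hb).2
      have h2 := norm_sum_unitExp_mul_abs_sub_round_le L (x b)
      have hF0 : 0 ≤ F b := norm_nonneg _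
      have h3 : F b * (2 * ρ) ≤ 1 :=
        (mul_le_mul_of_nonneg_left (by linarith) hF0).trans h2
      have h4 : (F b * (2 * ρ)) ^ 4 ≤ 1 := pow_le_one₀ (by positivity) h3
      have h5 : F b ^ 4 * ρ ^ 4 ≤ L ^ 3 / 16 * ρ ^ 4 := by
        have : (F b * (2 * ρ)) ^ 4 = 16 * (F b ^ 4 * ρ ^ 4) := by ring
        linarith
      exact le_of_mul_le_mul_right h5 (by positivity)
    refine (sum_le_card_nsmul _ _ _ hb).trans ?_
    rw [nsmul_eq_mul]
    refine mul_le_mul_of_nonneg_right ?_ (by positivity)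
    exact_mod_cast (card_filter_le _ _).trans (card_range N).le
  have h6 : (L : ℝ) ^ 4 * (N / (8 * L)) = N * L ^ 3 / 8 := by field_simp
  rw [h6] at h1
  have h7 : (N : ℝ) * L ^ 3 ≤ 4 * L * #{b ∈ range N | |x b - round (x b)| ≤ ρ} * L ^ 3 := by
    have : 0 ≤ (N : ℝ) * L ^ 3 := by positivity
    linarith
  exact le_of_mul_le_mul_right h7 (by positivity)

theorem eventually_mul_log_le {c s C : ℝ} (hc : 0 < c) (hs : 0 < s) :
    ∀ᶠ N : ℕ in Filter.atTop, C * (1 + Real.log (N + 1)) ≤ c * (N : ℝ) ^ s := by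
  have h1 : (fun x : ℝ => 1 + Real.log (x + 1)) =o[Filter.atTop] fun x : ℝ => (x + 1) ^ s := by
    have h2 : (fun x : ℝ => 1 + Real.log x) =o[Filter.atTop] fun x : ℝ => x ^ s := by
      refine Asymptotics.IsLittleO.add ?_ (isLittleO_log_rpow_atTop hs)
      rw [Asymptotics.isLittleO_const_left]
      right
      exact tendsto_norm_atTop_atTop.comp (tendsto_rpow_atTop hs)
    exact h2.comp_tendsto (Filter.tendsto_atTop_add_const_right _ 1 Filter.tendsto_id)
  have h3 := (h1.const_mul_left C).def (show 0 < c / 2 ^ s by positivity)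
  filter_upwards [tendsto_natCast_atTop_atTop.eventually h3, Filter.eventually_ge_atTop 1]
    with N hN hN1
  have hN1' : (1 : ℝ) ≤ N := by exact_mod_cast hN1
  refine (le_abs_self _).trans (hN.trans ?_)
  rw [Real.norm_of_nonneg (by positivity)]
  calc c / 2 ^ s * ((N : ℝ) + 1) ^ s ≤ c / 2 ^ s * (2 * (N : ℝ)) ^ s := by
        gcongr; linarith
    _ = c * (N : ℝ) ^ s := by
        rw [Real.mul_rpow (by norm_num) (by positivity)]
        field_simp

theorem norm_quadratic_sum_le_of_diophantine {θ κ c₀ : ℝ} (hκ : 1 ≤ κ) (hc₀ : 0 < c₀)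
    (hc₁ : c₀ ≤ 1)
    (hd : ∀ q : ℕ, 0 < q → ∀ p : ℤ, c₀ / (q : ℝ) ^ κ ≤ |(q : ℝ) * θ - p|) (B C : ℝ)
    {N L : ℕ} (hN : 0 < N) (hL : 0 < L)
    (hNL : 6144 * L ^ 3 * (1 + Real.log (N + 1)) ≤ (c₀ * N) ^ (1 / κ))
    {m : ℤ} (hm : m ≠ 0) (hmL : |m| < 2 * L) :
    ‖∑ b ∈ range N, unitExp (m * (θ * b ^ 2 + B * b + C))‖ ≤ N / (8 * L) := by
  have hNR : (1 : ℝ) ≤ N := by exact_mod_cast hN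
  have hLR : (1 : ℝ) ≤ L := by exact_mod_cast hL
  have hκ0 : 0 < κ := by linarith
  set X := (c₀ * N) ^ (1 / κ) with hX
  have hX0 : 0 < X := by positivity
  have hXκ : X ^ κ = c₀ * N := by
    rw [hX, ← Real.rpow_mul (by positivity), one_div_mul_cancel hκ0.ne', Real.rpow_one]
  have hXN : X ≤ N := by
    calc X ≤ (N : ℝ) ^ (1 / κ) := by
          refine Real.rpow_le_rpow (by positivity) ?_ (by positivity)
          nlinarith
      _ ≤ (N : ℝ) ^ (1 : ℝ) :=
          Real.rpow_le_rpow_of_exponent_le hNR ((div_le_one hκ0).mpr hκ)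
      _ = N := Real.rpow_one _
  set q := ⌊X / (4 * L)⌋₊ + 1 with hq
  have hqX : X / (4 * L) ≤ q := by
    rw [hq]; push_cast; exact (Nat.lt_floor_add_one _).le
  have hsep : ∀ k : ℕ, 0 < k → k < q → ∀ p : ℤ, 1 / (N : ℝ) ≤ |k * (2 * (m * θ)) - p| := by
    intro k hk hkq p
    have hmpos : 0 < m.natAbs := Int.natAbs_pos.mpr hm
    set n := 2 * m.natAbs * k with hn
    have hnpos : 0 < n := by positivity
    have hkX : (k : ℝ) ≤ X / (4 * L) := (Nat.le_floor_iff (by positivity)).mp (by omega)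
    have hmL' : (m.natAbs : ℝ) ≤ 2 * L := by
      rw [Int.abs_eq_natAbs] at hmL
      have : m.natAbs ≤ 2 * L := by omega
      exact_mod_cast this
    have hnX : (n : ℝ) ≤ X := by
      rw [le_div_iff₀ (by positivity)] at hkX
      rw [hn]
      push_cast
      nlinarith [mul_le_mul_of_nonneg_right hmL' (Nat.cast_nonneg (α := ℝ) k)]
    have h1 : 1 / (N : ℝ) ≤ c₀ / (n : ℝ) ^ κ := by
      rw [div_le_div_iff₀ (by positivity) (by positivity), one_mul, ← hXκ]
      exact Real.rpow_le_rpow (by positivity) hnX hκ0.le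
    refine h1.trans ?_
    have hnm : (n : ℝ) = 2 * |(m : ℝ)| * k := by
      rw [hn]; push_cast; rw [Nat.cast_natAbs]; push_cast; rfl
    rcases abs_cases (m : ℝ) with ⟨h, -⟩ | ⟨h, -⟩
    · refine (hd n hnpos p).trans (le_of_eq ?_)
      rw [hnm, h]; ring_nf
    · refine (hd n hnpos (-p)).trans (le_of_eq ?_)
      rw [hnm, h, ← abs_neg]; push_cast; ring_nf
  have h1 := norm_quadratic_sum_sq_le (m * θ) (m * B) (m * C) hN (Nat.succ_pos _) hsep
  have h2 : ∀ b : ℕ, (m : ℝ) * θ * b ^ 2 + m * B * b + m * C = m * (θ * b ^ 2 + B * b + C) :=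
    fun b => by ring
  simp_rw [h2] at h1
  refine le_of_sq_le_sq (h1.trans ?_) (by positivity)
  have hlog : 0 ≤ Real.log (N + 1) := Real.log_nonneg (by linarith)
  have h3 : (N : ℝ) / q + 1 ≤ 8 * L * N / X := by
    have a1 : (N : ℝ) / q ≤ N / (X / (4 * L)) := by gcongr
    have a2 : (N : ℝ) / (X / (4 * L)) = 4 * L * N / X := by field_simp
    have a3 : 1 ≤ 4 * L * N / X := by
      rw [le_div_iff₀ hX0]; nlinarith
    have a4 : 8 * L * N / X = 4 * L * N / X + 4 * L * N / X := by ring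
    linarith
  calc 12 * N * ((N : ℝ) / q + 1) * (1 + Real.log (N + 1))
      ≤ 12 * N * (8 * L * N / X) * (1 + Real.log (N + 1)) := by gcongr
    _ = N ^ 2 * (6144 * L ^ 3 * (1 + Real.log (N + 1))) / (64 * L ^ 2 * X) := by
        field_simp; ring
    _ ≤ N ^ 2 * X / (64 * L ^ 2 * X) := by gcongr
    _ = (N / (8 * L)) ^ 2 := by field_simp; ring

theorem eventually_le_card_quadratic_near_int {θ κ c₀ μ : ℝ} (hκ : 1 ≤ κ) (hc₀ : 0 < c₀)
    (hc₁ : c₀ ≤ 1)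
    (hd : ∀ q : ℕ, 0 < q → ∀ p : ℤ, c₀ / (q : ℝ) ^ κ ≤ |(q : ℝ) * θ - p|) (B C : ℝ)
    (hμ : μ < 1 / (4 * κ)) :
    ∀ᶠ N : ℕ in Filter.atTop, ∀ ρ : ℝ, (N : ℝ) ^ (-μ) ≤ ρ → ρ ≤ 1 →
      (N : ℝ) * ρ ^ 2 ≤ 8 * #((range N).filter fun b : ℕ => |θ * (b : ℝ) ^ 2 + B * b + C -
        round (θ * (b : ℝ) ^ 2 + B * b + C)| ≤ ρ) := by
  have hκ0 : 0 < κ := by linarith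
  have hs : 0 < 1 / κ - 4 * μ := by
    have : 1 / κ = 4 * (1 / (4 * κ)) := by field_simp
    linarith
  filter_upwards [eventually_mul_log_le (c := c₀ ^ (1 / κ)) (C := 49152) (by positivity) hs,
    Filter.eventually_ge_atTop 1] with N hNlog hN ρ hρ hρ1
  have hNR : (0 : ℝ) < N := by exact_mod_cast hN
  have hρ0 : 0 < ρ := (Real.rpow_pos_of_pos hNR _).trans_le hρ
  set Y := ρ ^ (-(4 / 3) : ℝ) with hY
  have hY1 : 1 ≤ Y := Real.one_le_rpow_of_pos_of_le_one_of_nonpos hρ0 hρ1 (by norm_num)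
  have hY3 : Y ^ 3 * ρ ^ 4 = 1 := by
    rw [hY, ← Real.rpow_natCast, ← Real.rpow_natCast ρ 4, ← Real.rpow_mul hρ0.le,
      ← Real.rpow_add hρ0]
    norm_num
  have hYρ : Y * ρ ^ 2 ≤ 1 := by
    rw [hY, ← Real.rpow_natCast ρ 2, ← Real.rpow_add hρ0]
    exact Real.rpow_le_one hρ0.le hρ1 (by norm_num)
  have hYN : Y ^ 3 ≤ (N : ℝ) ^ (4 * μ) := by
    rw [eq_inv_of_mul_eq_one_left hY3, inv_le_comm₀ (by positivity) (by positivity),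
      ← Real.rpow_neg hNR.le]
    calc (N : ℝ) ^ (-(4 * μ)) = ((N : ℝ) ^ (-μ)) ^ 4 := by
          rw [← Real.rpow_natCast, ← Real.rpow_mul hNR.le]; congr 1; push_cast; ring
      _ ≤ ρ ^ 4 := by gcongr
  set L := ⌈Y⌉₊ with hL
  have hYL : Y ≤ L := Nat.le_ceil Y
  have hL0 : 0 < L := Nat.ceil_pos.mpr (by linarith)
  have hL2 : (L : ℝ) ≤ 2 * Y := by
    have := Nat.ceil_lt_add_one (show 0 ≤ Y by linarith)
    linarith
  have hlog : 0 ≤ Real.log (N + 1) := Real.log_nonneg (by linarith)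
  have hNL : 6144 * (L : ℝ) ^ 3 * (1 + Real.log (N + 1)) ≤ (c₀ * N) ^ (1 / κ) := by
    calc 6144 * (L : ℝ) ^ 3 * (1 + Real.log (N + 1))
        ≤ 6144 * (2 * Y) ^ 3 * (1 + Real.log (N + 1)) := by gcongr
      _ = Y ^ 3 * (49152 * (1 + Real.log (N + 1))) := by ring
      _ ≤ (N : ℝ) ^ (4 * μ) * (c₀ ^ (1 / κ) * (N : ℝ) ^ (1 / κ - 4 * μ)) := by gcongr
      _ = (c₀ * N) ^ (1 / κ) := by
          rw [Real.mul_rpow hc₀.le hNR.le, mul_left_comm, ← Real.rpow_add hNR]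
          congr 2; ring
  have h1 := le_card_near_int (N := N) (L := L) (ρ := ρ) (fun b => θ * (b : ℝ) ^ 2 + B * b + C)
    hL0 hρ0 (hY3 ▸ by gcongr) fun m hm hmL =>
      norm_quadratic_sum_le_of_diophantine hκ hc₀ hc₁ hd B C hN hL0 hNL hm hmL
  set K := #((range N).filter fun b : ℕ => |θ * (b : ℝ) ^ 2 + B * b + C -
        round (θ * (b : ℝ) ^ 2 + B * b + C)| ≤ ρ)
  have hK : (0 : ℝ) ≤ K := Nat.cast_nonneg _
  calc (N : ℝ) * ρ ^ 2 ≤ 4 * L * K * ρ ^ 2 := by gcongr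
    _ ≤ 4 * (2 * Y) * K * ρ ^ 2 := by gcongr
    _ = 8 * K * (Y * ρ ^ 2) := by ring
    _ ≤ 8 * K * 1 := by gcongr
    _ = 8 * K := mul_one _

theorem diophantine_one_div_four_mul_int_add {α κ c₀ : ℝ} (hκ : 1 ≤ κ) (hc₀ : 0 < c₀)
    (hd : ∀ q : ℕ, 0 < q → ∀ p : ℤ, c₀ / (q : ℝ) ^ κ ≤ |(q : ℝ) * α - p|)
    (a : ℤ) (ha : 1 ≤ a + α) :
    ∃ c₁ : ℝ, 0 < c₁ ∧ c₁ ≤ 1 ∧ ∀ q : ℕ, 0 < q → ∀ p : ℤ,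
      c₁ / (q : ℝ) ^ κ ≤ |(q : ℝ) * (1 / (4 * (a + α))) - p| := by
  set A := (a : ℝ) + α with hA
  have hA0 : 0 < A := by linarith
  have hκ0 : 0 < κ := by linarith
  refine ⟨min (1 / (4 * A)) (c₀ / (8 ^ κ * (4 * A))), by positivity, ?_, ?_⟩
  · refine (min_le_left _ _).trans ?_
    rw [div_le_one (by positivity)]; linarith
  intro q hq p
  have hqR : (1 : ℝ) ≤ q := by exact_mod_cast hq
  have hqκ : 1 ≤ (q : ℝ) ^ κ := Real.one_le_rpow hqR hκ0.le
  rcases eq_or_ne p 0 with rfl | hp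
  · rw [Int.cast_zero, sub_zero, abs_of_nonneg (by positivity)]
    calc min (1 / (4 * A)) (c₀ / (8 ^ κ * (4 * A))) / (q : ℝ) ^ κ
        ≤ (1 / (4 * A)) / 1 := by
          gcongr
          exact min_le_left _ _
      _ ≤ q * (1 / (4 * A)) := by
          rw [div_one]
          exact le_mul_of_one_le_left (by positivity) hqR
  by_cases hbig : 1 ≤ |(q : ℝ) * (1 / (4 * A)) - p|
  · refine le_trans ?_ hbig
    rw [div_le_one (by positivity)]
    refine (min_le_left _ _).trans (le_trans ?_ hqκ)
    rw [div_le_one (by positivity)]; linarith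
  push Not at hbig
  have hn : 0 < 4 * p.natAbs := by have := Int.natAbs_pos.mpr hp; omega
  have hnabs : ((4 * p.natAbs : ℕ) : ℝ) = 4 * |(p : ℝ)| := by
    push_cast; rw [Nat.cast_natAbs]; push_cast; rfl
  have hle : 4 * |(p : ℝ)| ≤ 8 * q := by
    have h1 : (q : ℝ) * (1 / (4 * A)) ≤ q * 1 := by
      gcongr
      rw [div_le_one (by positivity)]; linarith
    have h2 : 0 ≤ (q : ℝ) * (1 / (4 * A)) := by positivity
    have h3 := abs_lt.mp hbig
    have : |(p : ℝ)| ≤ 2 * q := by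
      rw [abs_le]; constructor <;> linarith [h3.1, h3.2]
    linarith
  have key : c₀ / (4 * |(p : ℝ)|) ^ κ ≤ |4 * A * (q * (1 / (4 * A)) - p)| := by
    have e : 4 * A * (q * (1 / (4 * A)) - p) = q - 4 * p * a - 4 * p * α := by
      rw [mul_sub, hA]
      rw [hA] at hA0
      field_simp
      ring
    rw [e, ← hnabs]
    rcases abs_cases (p : ℝ) with ⟨h, -⟩ | ⟨h, -⟩
    · refine (hd _ hn (q - 4 * p * a)).trans (le_of_eq ?_)
      rw [hnabs, h, ← abs_neg]; push_cast; ring_nf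
    · refine (hd _ hn (-(q - 4 * p * a))).trans (le_of_eq ?_)
      rw [hnabs, h]; push_cast; ring_nf
  rw [abs_mul, abs_of_pos (by positivity : 0 < 4 * A), mul_comm (4 * A),
    ← div_le_iff₀ (by positivity)] at key
  refine le_trans ?_ key
  have hp0 : 0 < |(p : ℝ)| := abs_pos.mpr (Int.cast_ne_zero.mpr hp)
  calc min (1 / (4 * A)) (c₀ / (8 ^ κ * (4 * A))) / (q : ℝ) ^ κ
      ≤ (c₀ / (8 ^ κ * (4 * A))) / (q : ℝ) ^ κ := by
        gcongr
        exact min_le_right _ _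
    _ = c₀ / (8 * (q : ℝ)) ^ κ / (4 * A) := by
        rw [Real.mul_rpow (by norm_num) (by positivity)]
        field_simp
    _ ≤ c₀ / (4 * |(p : ℝ)|) ^ κ / (4 * A) := by gcongr

theorem abs_le_enorm3 (v : Fin 3 → ℝ) (i : Fin 3) : |v i| ≤ enorm3 v :=
  Real.abs_le_sqrt (single_le_sum (f := fun i => v i ^ 2) (fun _ _ => sq_nonneg _) (mem_univ i))

theorem enorm3_le (v : Fin 3 → ℝ) : enorm3 v ≤ |v 0| + |v 1| + |v 2| := by
  rw [enorm3, Real.sqrt_le_left (by positivity), Fin.sum_univ_three,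
    ← sq_abs (v 0), ← sq_abs (v 1), ← sq_abs (v 2)]
  have h0 := abs_nonneg (v 0)
  have h1 := abs_nonneg (v 1)
  have h2 := abs_nonneg (v 2)
  nlinarith [mul_nonneg h0 h1, mul_nonneg h0 h2, mul_nonneg h1 h2]

theorem finite_setOf_enorm3_le (T : ℝ) :
    {v : Fin 3 → ℤ | enorm3 (fun i => (v i : ℝ)) ≤ T}.Finite := by
  refine (Set.finite_Icc (fun _ : Fin 3 => -⌊T⌋) (fun _ => ⌊T⌋)).subset fun v hv => ?_
  have h : ∀ i, |v i| ≤ ⌊T⌋ := fun i => by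
    rw [Int.le_floor, Int.cast_abs]
    exact (abs_le_enorm3 _ i).trans hv
  exact ⟨fun i => (abs_le.mp (h i)).1, fun i => (abs_le.mp (h i)).2⟩

theorem card_near_int_le_ncard {α β γ t δ T : ℝ} {a : ℤ} (hA : 0 < a + α) {N : ℕ} {B C : ℝ}
    (hB : B = 2 * β * (1 / (4 * (a + α)))) (hC : C = (β ^ 2 - t) * (1 / (4 * (a + α))) - γ)
    (hT : (|(a : ℝ)| + 2 + 1 / (4 * (a + α)) + |B| + |C|) * N ^ 2 ≤ T) :
    #((range N).filter fun b : ℕ => |1 / (4 * (a + α)) * (b : ℝ) ^ 2 + B * b + C -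
        round (1 / (4 * (a + α)) * (b : ℝ) ^ 2 + B * b + C)| ≤ δ / (4 * (a + α))) ≤
      {v : Fin 3 → ℤ | enorm3 (fun i => (v i : ℝ)) ≤ T ∧
            |Qform ((fun i => (v i : ℝ)) + ![α, β, γ]) - t| ≤ δ}.ncard := by
  set θ := 1 / (4 * (a + α)) with hθ
  have hθ0 : 0 < θ := by positivity
  set f : ℕ → Fin 3 → ℤ := fun b => ![a, b, round (θ * (b : ℝ) ^ 2 + B * b + C)] with hf
  rw [← Set.ncard_coe_finset]
  refine Set.ncard_le_ncard_of_injOn f ?_ ?_ ((finite_setOf_enorm3_le T).subset fun v hv => hv.1)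
  · intro b hb
    simp only [coe_filter, mem_range, Set.mem_ofPred_eq] at hb
    obtain ⟨hbN, hb⟩ := hb
    have hbN' : (b : ℝ) ≤ N := by exact_mod_cast hbN.le
    have hN1 : (1 : ℝ) ≤ N := by exact_mod_cast (show 1 ≤ N by omega)
    have hb0 : (0 : ℝ) ≤ b := Nat.cast_nonneg b
    set x := θ * (b : ℝ) ^ 2 + B * b + C with hx
    constructor
    · refine (enorm3_le _).trans (le_trans ?_ hT)
      simp only [hf, Matrix.cons_val_zero, Matrix.cons_val_one, Matrix.cons_val, Int.cast_natCast]
      have hr : |(round x : ℝ)| ≤ |x| + 1 := by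
        have h1 := abs_sub_round x
        have h2 := abs_sub_abs_le_abs_sub (round x : ℝ) x
        rw [abs_sub_comm] at h2
        linarith
      have hNN : (N : ℝ) ≤ N ^ 2 := by nlinarith
      have hNN1 : (1 : ℝ) ≤ N ^ 2 := by nlinarith
      have hxx : |x| ≤ θ * N ^ 2 + |B| * N ^ 2 + |C| * N ^ 2 := by
        calc |x| ≤ |θ * (b : ℝ) ^ 2| + |B * b| + |C| := abs_add_three _ _ _
          _ = θ * (b : ℝ) ^ 2 + |B| * b + |C| * 1 := by
              rw [abs_mul, abs_mul, abs_of_pos hθ0, abs_of_nonneg hb0,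
                abs_of_nonneg (sq_nonneg _), mul_one]
          _ ≤ θ * N ^ 2 + |B| * N ^ 2 + |C| * N ^ 2 := by
              gcongr
              exact hbN'.trans hNN
      rw [abs_of_nonneg hb0]
      nlinarith [mul_le_mul_of_nonneg_left hNN1 (abs_nonneg (a : ℝ))]
    · have e : Qform ((fun i => (f b i : ℝ)) + ![α, β, γ]) - t =
          4 * (a + α) * (x - round x) := by
        simp only [Qform, hf, Pi.add_apply, Matrix.cons_val_zero, Matrix.cons_val_one,
          Matrix.cons_val, Int.cast_natCast]
        rw [mul_sub, hx, hB, hC, hθ]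
        field_simp
        ring
      rw [e, abs_mul, abs_of_pos (by positivity : 0 < 4 * (a + α)), mul_comm]
      exact (le_div_iff₀ (by positivity)).mp hb
  · intro b _ b' _ h
    simpa [hf] using congrFun h 1

theorem main_counting (α β γ : ℝ) (κ : ℝ) (hκ : 1 ≤ κ)
    (hdio : ∃ c₀ > 0, ∀ q : ℕ, 0 < q → ∀ p : ℤ, c₀ / (q : ℝ) ^ κ ≤ |(q : ℝ) * α - (p : ℝ)|)
    (ν : ℝ) (hν0 : 0 < ν) (hν : ν < 1 / (8 * κ)) (t : ℝ) :
    ∃ c > 0, ∃ T₀ : ℝ, 1 ≤ T₀ ∧ ∀ T : ℝ, T₀ ≤ T → ∀ δ : ℝ, T ^ (-ν) ≤ δ → δ < 1 →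
      c * T ^ ((1 : ℝ) / 2) * δ ^ 2 ≤
        ({v : Fin 3 → ℤ | enorm3 (fun i => (v i : ℝ)) ≤ T ∧
            |Qform ((fun i => (v i : ℝ)) + ![α, β, γ]) - t| ≤ δ}.ncard : ℝ) := by
  obtain ⟨c₀, hc₀, hd⟩ := hdio
  have hκ0 : 0 < κ := by linarith
  set a : ℤ := ⌈-α⌉ + 1 with ha
  have hA1 : 1 ≤ (a : ℝ) + α := by
    have := Int.le_ceil (-α)
    rw [ha]; push_cast; linarith
  have hA : 0 < (a : ℝ) + α := by linarith
  obtain ⟨c₁, hc₁, hc₁', hd'⟩ := diophantine_one_div_four_mul_int_add hκ hc₀ hd a hA1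
  obtain ⟨B, hB⟩ : ∃ B, B = 2 * β * (1 / (4 * (a + α))) := ⟨_, rfl⟩
  obtain ⟨C, hC⟩ : ∃ C, C = (β ^ 2 - t) * (1 / (4 * (a + α))) - γ := ⟨_, rfl⟩
  set K := |(a : ℝ)| + 2 + 1 / (4 * (a + α)) + |B| + |C| with hK
  have hK1 : 1 ≤ K := by
    have : 0 < 1 / (4 * (a + α)) := by positivity
    linarith [abs_nonneg (a : ℝ), abs_nonneg B, abs_nonneg C]
  obtain ⟨μ, hμ1, hμ2⟩ : ∃ μ, 2 * ν < μ ∧ μ < 1 / (4 * κ) := by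
    refine exists_between ?_
    have : 1 / (4 * κ) = 2 * (1 / (8 * κ)) := by field_simp; norm_num
    linarith
  have hev : ∀ᶠ N : ℕ in Filter.atTop, 4 * (a + α) * (4 * K) ^ ν ≤ (N : ℝ) ^ (μ - 2 * ν) :=
    ((tendsto_rpow_atTop (sub_pos.mpr hμ1)).comp tendsto_natCast_atTop_atTop).eventually_ge_atTop _
  obtain ⟨N₁, hN₁⟩ := Filter.eventually_atTop.mp
    ((eventually_le_card_quadratic_near_int hκ hc₁ hc₁' hd' B C hμ2).and hev)
  refine ⟨1 / (256 * √K * (a + α) ^ 2), by positivity, K * (N₁ + 1) ^ 2, ?_, ?_⟩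
  · nlinarith [Nat.cast_nonneg (α := ℝ) N₁, sq_nonneg (N₁ : ℝ)]
  intro T hT δ hδ hδ1
  have hT0 : 0 < T := lt_of_lt_of_le (by positivity) hT
  set N := ⌊√(T / K)⌋₊ with hN
  have hle : (N : ℝ) ≤ √(T / K) := Nat.floor_le (Real.sqrt_nonneg _)
  have hlt : √(T / K) < N + 1 := Nat.lt_floor_add_one _
  have hsq : √(T / K) ^ 2 = T / K := Real.sq_sqrt (by positivity)
  have hNge : N₁ + 1 ≤ N := by
    refine Nat.le_floor (Real.le_sqrt_of_sq_le ?_)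
    rw [le_div_iff₀ (by positivity)]
    push_cast
    linarith
  have hN1 : (1 : ℝ) ≤ N := by exact_mod_cast (show 1 ≤ N by omega)
  have hNT : K * (N : ℝ) ^ 2 ≤ T := by
    have : (N : ℝ) ^ 2 ≤ T / K := hsq ▸ (by gcongr)
    rw [le_div_iff₀ (by positivity)] at this
    linarith
  have hTN : T ≤ 4 * K * (N : ℝ) ^ 2 := by
    have h1 : √(T / K) ^ 2 ≤ (2 * (N : ℝ)) ^ 2 := by
      gcongr; linarith
    rw [hsq, div_le_iff₀ (by positivity)] at h1
    linarith
  obtain ⟨hcount, hlarge⟩ := hN₁ N (by omega)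
  have hδρ : (N : ℝ) ^ (-μ) ≤ δ / (4 * (a + α)) := by
    rw [le_div_iff₀ (by positivity)]
    refine le_trans ?_ hδ
    calc (N : ℝ) ^ (-μ) * (4 * (a + α))
        = (N : ℝ) ^ (-μ) * (4 * (a + α) * (4 * K) ^ ν) * (4 * K) ^ (-ν) := by
          rw [mul_assoc, mul_assoc (4 * (a + α) : ℝ), ← Real.rpow_add (by positivity),
            add_neg_cancel, Real.rpow_zero, mul_one]
      _ ≤ (N : ℝ) ^ (-μ) * (N : ℝ) ^ (μ - 2 * ν) * (4 * K) ^ (-ν) := by gcongr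
      _ = (4 * K * (N : ℝ) ^ 2) ^ (-ν) := by
          rw [← Real.rpow_add (by positivity),
            Real.mul_rpow (x := 4 * K) (by positivity) (by positivity),
            ← Real.rpow_natCast, ← Real.rpow_mul (by positivity), mul_comm]
          congr 2
          push_cast; ring
      _ ≤ T ^ (-ν) := Real.rpow_le_rpow_of_nonpos hT0 hTN (by linarith)
  have hδ0 : 0 < δ := (Real.rpow_pos_of_pos hT0 _).trans_le hδ
  have h1 := hcount (δ / (4 * (a + α))) hδρ (by rw [div_le_one (by positivity)]; linarith)
  have h2 : ((_ : ℕ) : ℝ) ≤ ((_ : ℕ) : ℝ) :=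
    Nat.cast_le.mpr (card_near_int_le_ncard (δ := δ) hA hB hC (hK ▸ hNT))
  have hTsqrt : T ^ ((1 : ℝ) / 2) ≤ 2 * √K * N := by
    rw [← Real.sqrt_eq_rpow]
    refine Real.sqrt_le_iff.mpr ⟨by positivity, ?_⟩
    rw [mul_pow, mul_pow, Real.sq_sqrt (by positivity)]
    linarith
  calc 1 / (256 * √K * (a + α) ^ 2) * T ^ ((1 : ℝ) / 2) * δ ^ 2
      ≤ 1 / (256 * √K * (a + α) ^ 2) * (2 * √K * N) * δ ^ 2 := by gcongr
    _ = (N : ℝ) * (δ / (4 * (a + α))) ^ 2 / 8 := by field_simp; norm_num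
    _ ≤ _ := by linarith
end
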